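/- Let k, h ≥ 1 and let G and H be finite simple graphs. Build the simplicial walk automata A(G,k,h) and A(H,k,h) over a common alphabet Σ whose color symbols range over the union of the images of χ_{k,h}(G,−) and χ_{k,h}(H,−). Then the recognized rational series satisfy ⟦A(G,k,h)⟧ = ⟦A(H,k,h)⟧ if and only if Sww_{(k,h)}(G) = Sww_{(k,h)}(H). -/

import Mathlib

open Matrix

/-- Atomic type of a `k`-tuple: for each pair of indices, whether the entries are
equal and whether they are adjacent. -/
def AtpType (k : ℕ) : Type := Fin k → Fin k → Prop × Prop

/-- The atomic type of a `k`-tuple of vertices of a graph. -/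
def atp {V : Type} (G : SimpleGraph V) (k : ℕ) (u : Fin k → V) : AtpType k :=
  fun i j => (u i = u j, G.Adj (u i) (u j))

/-- The value type of the `k`-dimensional Weisfeiler–Leman coloring after `h` rounds. -/
def WLColor (k : ℕ) : ℕ → Type
  | 0 => AtpType k
  | h + 1 => WLColor k h × Multiset (AtpType (k + 1) × (Fin k → WLColor k h))

/-- The `k`-dimensional Weisfeiler–Leman coloring of `k`-tuples, after `h` rounds. -/
def wl {V : Type} [Fintype V] (G : SimpleGraph V) (k : ℕ) :
    (h : ℕ) → (Fin k → V) → WLColor k h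
  | 0, u => atp G k u
  | h + 1, u =>
      (wl G k h u,
        (Finset.univ : Finset V).val.map fun v =>
          (atp G (k + 1) (Fin.snoc u v), fun p => wl G k h (Function.update u p v)))

/-- Common value type for the colors `χ_{k,h}` of nonempty tuples of length `≤ k+1`. -/
def ColorType (k : ℕ) : Type := (Σ d : ℕ, WLColor k d) ⊕ AtpType (k + 1)

/-- The coloring `χ_{k,h}` of nonempty tuples (given as lists) of vertices:
an `ℓ`-tuple with `ℓ ≤ k` is padded with its last entry to a `k`-tuple and colored by
`χ_k^(k+h-ℓ)`; a `(k+1)`-tuple is colored by its atomic type. Empty lists get `none`. -/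
def chiKH {V : Type} [Fintype V] (G : SimpleGraph V) (k h : ℕ) :
    List V → Option (ColorType k)
  | [] => none
  | v :: vs =>
      let u := v :: vs
      let last := u.getLastD v
      if u.length ≤ k then
        some (Sum.inl ⟨k + h - u.length, wl G k (k + h - u.length) fun i => u.getD i last⟩)
      else
        some (Sum.inr (atp G (k + 1) fun i => u.getD i last))

/-- One step of a `k`-simplicial walk, on states given as duplicate-free tuples
(ordered by the time their entries became incoming): either a new vertex becomes
incoming (appended at the end, sets of size at most `k+1`), or a vertex at some
position is outgoing (sets stay nonempty). -/
inductive SWStep (V : Type) (k : ℕ) : List V → List V → Prop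
  | add (l : List V) (x : V) (hx : x ∉ l) (hl : l.length ≤ k) : SWStep V k l (l ++ [x])
  | remove (l : List V) (p : ℕ) (hp : p < l.length) (hl : 2 ≤ l.length) :
      SWStep V k l (l.eraseIdx p)

/-- A `k`-simplicial walk: a nonempty sequence of states starting from a single vertex,
consecutive states related by `SWStep`. -/
structure SWalk (V : Type) (k : ℕ) where
  states : List (List V)
  first_single : ∃ v : V, states.head? = some [v]
  steps : states.Chain' (SWStep V k)

/-- Number of occurrences of the `h`-color word `c` among `k`-simplicial walks in `G`. -/
noncomputable def swCount {V : Type} [Fintype V] (G : SimpleGraph V) (k h : ℕ)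
    (c : List (Option (ColorType k))) : ℕ :=
  Set.ncard {w : SWalk V k | w.states.map (chiKH G k h) = c}

/-- The number of times a vertex `v` is incoming in a sequence of states. -/
noncomputable def incomingCount {W : Type} (s : List (List W)) (v : W) : ℕ :=
  Set.ncard {i : ℕ | i < s.length ∧
    ((i = 0 ∧ s.getD 0 [] = [v]) ∨ (1 ≤ i ∧ s.getD i [] = s.getD (i - 1) [] ++ [v]))}
/-- The multiset of color words assigned by the `(k,h)` simplicial-walk refinement after
`t` rounds to a tuple `u` (given as a list) of vertices of `G`. -/
def swRef {V : Type} [Fintype V] (G : SimpleGraph V) (k h : ℕ) :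
    ℕ → List V → Multiset (List (Option (ColorType k)))
  | 0, u => if u.length = 1 then {[chiKH G k h u]} else 0
  | t + 1, u =>
      (if 1 < u.length then
        (swRef G k h t u.dropLast).map (fun c => c ++ [chiKH G k h u]) else 0) +
      (if u.length ≤ k then
        ∑ p ∈ Finset.range (u.length + 1), ∑ x : V,
          (swRef G k h t (u.insertIdx p x)).map (fun c => c ++ [chiKH G k h u])
       else 0)

/-- `Sw_{(k,h)}^t(G)`: the multiset union of the refinement multisets over all nonempty
tuples of length at most `k`. -/
def SwT {V : Type} [Fintype V] (G : SimpleGraph V) (k h t : ℕ) :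
    Multiset (List (Option (ColorType k))) :=
  ∑ n ∈ Finset.range k, ∑ u : Fin (n + 1) → V, swRef G k h t (List.ofFn u)
/-- The state set `Q_k`: nonempty tuples of length at most `k` with pairwise distinct
entries, encoded as embeddings `Fin (n+1) ↪ V` for `n < k`. -/
def QIdx (V : Type) (k : ℕ) : Type := Σ n : Fin k, Fin (n.val + 1) ↪ V

noncomputable instance {V : Type} [Fintype V] [DecidableEq V] {k : ℕ} : Fintype (QIdx V k) := by
  unfold QIdx; infer_instance

/-- The list of entries of a state in `Q_k`. -/
def qList {V : Type} {k : ℕ} (q : QIdx V k) : List V := List.ofFn q.2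

open scoped Classical in
/-- The color-partition matrix `P_a`. -/
noncomputable def Pmat {V : Type} [Fintype V] (G : SimpleGraph V) (k h : ℕ)
    (a : ColorType k) : Matrix (QIdx V k) (QIdx V k) ℚ :=
  Matrix.of fun u v =>
    if u = v ∧ chiKH G k h (qList u) = some a then 1 else 0

open scoped Classical in
/-- The incoming matrix `D_p^+`. -/
noncomputable def DmatP (V : Type) (k : ℕ) (p : Fin k) :
    Matrix (QIdx V k) (QIdx V k) ℚ :=
  Matrix.of fun u v =>
    if p.val < (qList v).length ∧ qList u = (qList v).eraseIdx p.val then 1 else 0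

open scoped Classical in
/-- The outgoing matrix `D_p^-`. -/
noncomputable def DmatM (V : Type) (k : ℕ) (p : Fin k) :
    Matrix (QIdx V k) (QIdx V k) ℚ :=
  Matrix.of fun u v =>
    if p.val < (qList u).length ∧ (qList u).eraseIdx p.val = qList v then 1 else 0

open scoped Classical in
/-- The atomic-type matrix `T_p^τ`. -/
noncomputable def Tmat {V : Type} (G : SimpleGraph V) (k : ℕ) (τ : AtpType 2) (p : Fin k) :
    Matrix (QIdx V k) (QIdx V k) ℚ :=
  Matrix.of fun u v =>
    if (∃ x y : V, (qList u)[p.val]? = some x ∧ (qList v)[p.val]? = some y ∧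
        (qList u).eraseIdx p.val = (qList v).eraseIdx p.val ∧
        atp G 2 ![x, y] = τ) then 1 else 0
/-- Letters of the alphabet of a simplicial walk automaton: either `(a, s, b)` with colors
`a, b` and a sign `s` (`false` for `−`, `true` for `+`), or `(a, τ, p, b)` with an atomic
2-type `τ` and a position `p ∈ [k]`. -/
def Letter (C : Type) (k : ℕ) : Type := (C × Bool × C) ⊕ (C × AtpType 2 × Fin k × C)

/-- The transition matrices of the simplicial walk automaton `A(G,k,h)`, where `cval`
interprets alphabet color symbols as actual colors. -/
noncomputable def swaTrans {V : Type} [Fintype V] [DecidableEq V] (G : SimpleGraph V)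
    (k h : ℕ) {C : Type} (cval : C → ColorType k) :
    Letter C k → Matrix (QIdx V k) (QIdx V k) ℚ
  | Sum.inl (a, s, b) =>
      ∑ p : Fin k,
        Pmat G k h (cval a) * (if s then DmatP V k p else DmatM V k p) * Pmat G k h (cval b)
  | Sum.inr (a, τ, p, b) => Pmat G k h (cval a) * Tmat G k τ p * Pmat G k h (cval b)

/-- The rational series recognized by the simplicial walk automaton `A(G,k,h)`
(with all-ones initial and final vectors). -/
noncomputable def swaSeries {V : Type} [Fintype V] [DecidableEq V] (G : SimpleGraph V)
    (k h : ℕ) {C : Type} (cval : C → ColorType k) (w : List (Letter C k)) : ℚ :=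
  (fun _ => (1 : ℚ)) ⬝ᵥ
    w.foldr (fun c v => (swaTrans G k h cval c).mulVec v) (fun _ => (1 : ℚ))

/-- The union of the images of `χ_{k,h}(G,−)` and `χ_{k,h}(H,−)` on nonempty tuples. -/
def colorSet {V W : Type} [Fintype V] [Fintype W] (G : SimpleGraph V) (H : SimpleGraph W)
    (k h : ℕ) : Set (ColorType k) :=
  {a | (∃ u : List V, chiKH G k h u = some a) ∨ ∃ u : List W, chiKH H k h u = some a}

namespace SWP
set_option linter.unusedSectionVars false
set_option linter.unusedSimpArgs false
set_option linter.unnecessarySimpa false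
open scoped Classical

/-- equal multisets of values give a bijection -/
theorem exists_equiv_of_map_eq {A B X : Type*} [Fintype A] [Fintype B] (f : A → X) (g : B → X)
    (h : (Finset.univ : Finset A).val.map f = (Finset.univ : Finset B).val.map g) :
    ∃ e : A ≃ B, ∀ a, f a = g (e a) := by
  have hc : ∀ x, Nonempty ({a // f a = x} ≃ {b // g b = x}) := by
    intro x
    rw [← Fintype.card_eq]
    have := congrArg (Multiset.count x) h
    rw [Multiset.count_map, Multiset.count_map] at this
    rw [Fintype.card_subtype, Fintype.card_subtype]
    simpa [Finset.card, eq_comm] using this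
  refine ⟨(Equiv.sigmaFiberEquiv f).symm.trans
    ((Equiv.sigmaCongrRight fun x => Classical.choice (hc x)).trans (Equiv.sigmaFiberEquiv g)), ?_⟩
  intro a
  simp only [Equiv.trans_apply]
  exact ((Classical.choice (hc (f a)) ⟨a, rfl⟩).2).symm

section
variable {V W : Type} [Fintype V] [Fintype W] (G : SimpleGraph V) (H : SimpleGraph W)

theorem map_eq_of_equiv {A B X : Type*} [Fintype A] [Fintype B] (f : A → X) (g : B → X)
    (e : A ≃ B) (h : ∀ a, f a = g (e a)) :
    (Finset.univ : Finset A).val.map f = (Finset.univ : Finset B).val.map g := by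
  have : f = g ∘ e := funext h
  rw [this, ← Multiset.map_map]
  congr 1
  have := congrArg Finset.val (Finset.map_univ_equiv e)
  simpa using this

theorem wl_succ_iff (k r : ℕ) (s : Fin k → V) (t : Fin k → W) :
    wl G k (r+1) s = wl H k (r+1) t ↔ wl G k r s = wl H k r t ∧
      ∃ e : V ≃ W, ∀ v, atp G (k+1) (Fin.snoc s v) = atp H (k+1) (Fin.snoc t (e v)) ∧
        ∀ p, wl G k r (Function.update s p v) = wl H k r (Function.update t p (e v)) := by
  constructor
  · intro h
    have h1 := congrArg Prod.fst h
    have h2 := congrArg Prod.snd h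
    refine ⟨h1, ?_⟩
    obtain ⟨e, he⟩ := exists_equiv_of_map_eq _ _ h2
    refine ⟨e, fun v => ?_⟩
    have := he v
    exact ⟨congrArg Prod.fst this, fun p => congrFun (congrArg Prod.snd this) p⟩
  · rintro ⟨h1, e, he⟩
    refine Prod.ext h1 ?_
    apply map_eq_of_equiv _ _ e
    intro v
    exact Prod.ext (he v).1 (funext (he v).2)

theorem wl_atp (k r : ℕ) (s : Fin k → V) (t : Fin k → W)
    (h : wl G k r s = wl H k r t) : atp G k s = atp H k t := by
  induction r with
  | zero => exact h
  | succ r ih => exact ih ((wl_succ_iff G H k r s t).1 h).1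

theorem atp_comp {n m : ℕ} (s : Fin n → V) (t : Fin n → W) (h : atp G n s = atp H n t)
    (φ : Fin m → Fin n) : atp G m (s ∘ φ) = atp H m (t ∘ φ) := by
  funext i j
  exact congrFun (congrFun h (φ i)) (φ j)

theorem exists_unused {k : ℕ} (φ : Fin k → Fin k) (p : Fin k) : ∃ q, ∀ j, j ≠ p → φ j ≠ q := by
  by_contra hc
  push Not at hc
  choose f hf1 hf2 using hc
  have hinj : Function.Injective f := by
    intro a b hab
    rw [← hf2 a, ← hf2 b, hab]
  have := Finite.surjective_of_injective hinj p
  obtain ⟨a, ha⟩ := this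
  exact hf1 a ha

theorem update_comp_unused {X : Type*} {k : ℕ} (φ : Fin k → Fin k) (p q : Fin k)
    (hq : ∀ j, j ≠ p → φ j ≠ q) (s : Fin k → X) (v : X) :
    Function.update (s ∘ φ) p v = Function.update s q v ∘ Function.update φ p q := by
  funext j
  by_cases hj : j = p
  · subst hj; simp
  · simp [Function.update_of_ne hj, Function.update_of_ne (hq j hj)]

theorem snoc_comp_lift {X : Type*} {k : ℕ} (φ : Fin k → Fin k) (s : Fin k → X) (v : X) :
    (Fin.snoc (s ∘ φ) v : Fin (k+1) → X) = (Fin.snoc s v : Fin (k+1) → X) ∘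
      (Fin.snoc (fun j => (φ j).castSucc) (Fin.last k) : Fin (k+1) → Fin (k+1)) := by
  funext j
  refine Fin.lastCases ?_ (fun j => ?_) j <;> simp

theorem wl_comp (k r : ℕ) : ∀ (s : Fin k → V) (t : Fin k → W)
    (_ : wl G k r s = wl H k r t) (φ : Fin k → Fin k), wl G k r (s ∘ φ) = wl H k r (t ∘ φ) := by
  induction r with
  | zero => intro s t h φ; exact atp_comp G H s t h φ
  | succ r ih =>
    intro s t h φ
    rw [wl_succ_iff] at h ⊢
    obtain ⟨h1, e, he⟩ := h
    refine ⟨ih s t h1 φ, e, fun v => ⟨?_, fun p => ?_⟩⟩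
    · rw [snoc_comp_lift, snoc_comp_lift]
      exact atp_comp G H _ _ (he v).1 _
    · obtain ⟨q, hq⟩ := exists_unused φ p
      rw [update_comp_unused φ p q hq, update_comp_unused φ p q hq]
      exact ih _ _ ((he v).2 q) _

theorem wl_mono (k r r' : ℕ) (hr : r ≤ r') (s : Fin k → V) (t : Fin k → W)
    (h : wl G k r' s = wl H k r' t) : wl G k r s = wl H k r t := by
  induction r', hr using Nat.le_induction with
  | base => exact h
  | succ n hn ih => exact ih ((wl_succ_iff G H k n s t).1 h).1

theorem wl_iso (e : V ≃ W) (he : ∀ x y, G.Adj x y ↔ H.Adj (e x) (e y)) (k r : ℕ) :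
    ∀ (s : Fin k → V), wl G k r s = wl H k r (e ∘ s) := by
  have hatp : ∀ n (s : Fin n → V), atp G n s = atp H n (e ∘ s) := by
    intro n s; funext i j
    simp [atp, he]
  induction r with
  | zero => intro s; exact hatp k s
  | succ r ih =>
    intro s
    rw [wl_succ_iff]
    refine ⟨ih s, e, fun v => ⟨?_, fun p => ?_⟩⟩
    · rw [hatp, Fin.comp_snoc]
    · rw [ih, Function.comp_update]

/-- `χ` on tuples of length between `1` and `k` -/
theorem chi_eq_iff (k h : ℕ) (n m : ℕ) (hn1 : 1 ≤ n) (hn : n ≤ k) (hm1 : 1 ≤ m) (hm : m ≤ k)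
    (u : Fin n → V) (v : Fin m → W) :
    chiKH G k h (List.ofFn u) = chiKH H k h (List.ofFn v) ↔
      n = m ∧ wl G k (k + h - n) (fun j => u ⟨min j.1 (n-1), by omega⟩)
        = wl H k (k + h - n) (fun j => v ⟨min j.1 (m-1), by omega⟩) := by
  have key : ∀ {V : Type} [Fintype V] (G : SimpleGraph V) (n : ℕ) (hn1 : 1 ≤ n) (hn : n ≤ k) (u : Fin n → V),
      chiKH G k h (List.ofFn u) = some (Sum.inl ⟨k + h - n, wl G k (k + h - n) (fun j => u ⟨min j.1 (n-1), by omega⟩)⟩) := by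
    intro V _ G n hn1 hn u
    obtain ⟨n, rfl⟩ : ∃ n', n = n' + 1 := ⟨n - 1, by omega⟩
    have gen : ∀ (l : List V) (N : ℕ) (w : Fin k → V) (v : V) (vs : List V), l = v :: vs →
        l.length = N → N ≤ k → (∀ j : Fin k, l.getD j (l.getLastD v) = w j) →
        chiKH G k h l = some (Sum.inl ⟨k + h - N, wl G k (k + h - N) w⟩) := by
      intro l N w v vs hl hN hNk hw
      subst hN
      subst hl
      have hd : chiKH G k h (v :: vs) = if (v :: vs).length ≤ k then
          (some (Sum.inl ⟨k + h - (v :: vs).length, wl G k (k + h - (v :: vs).length)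
            fun i => (v :: vs).getD i ((v :: vs).getLastD v)⟩) : Option (ColorType k))
          else some (Sum.inr (atp G (k + 1) fun i => (v :: vs).getD i ((v :: vs).getLastD v))) := rfl
      rw [hd, if_pos hNk]
      have : (fun i : Fin k => (v :: vs).getD i.1 ((v::vs).getLastD v)) = w := funext hw
      rw [this]
      rfl
    refine gen _ _ _ (u 0) _ List.ofFn_succ (by simp) hn ?_
    intro j
    by_cases hj : j.1 < n + 1
    · rw [List.getD_eq_getElem _ _ (by simpa using hj)]
      simp only [List.getElem_ofFn]
      congr 1; apply Fin.ext; simp; omega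
    · rw [List.getD_eq_default _ _ (by simp; omega)]
      rw [List.getLastD_eq_getLast?, List.getLast?_eq_getElem?, List.getElem?_eq_getElem (by simp)]
      simp only [List.getElem_ofFn, Option.getD_some, List.length_ofFn]
      congr 1; apply Fin.ext; simp; omega
  rw [key G n hn1 hn u, key H m hm1 hm v]
  constructor
  · intro hh
    have := Sum.inl.inj (Option.some.inj hh)
    have h1 := congrArg Sigma.fst this
    simp only at h1
    have hnm : n = m := by omega
    subst hnm
    refine ⟨rfl, ?_⟩
    exact eq_of_heq (Sigma.mk.inj this).2
  · rintro ⟨rfl, h2⟩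
    rw [h2]

theorem chi_top (k h : ℕ) (u : Fin (k+1) → V) :
    chiKH G k h (List.ofFn u) = some (Sum.inr (atp G (k+1) u)) := by
  have gen : ∀ (l : List V) (w : Fin (k+1) → V) (v : V) (vs : List V), l = v :: vs →
      ¬ l.length ≤ k → (∀ j : Fin (k+1), l.getD j (l.getLastD v) = w j) →
      chiKH G k h l = some (Sum.inr (atp G (k+1) w)) := by
    intro l w v vs hl hNk hw
    subst hl
    have hd : chiKH G k h (v :: vs) = if (v :: vs).length ≤ k then
          (some (Sum.inl ⟨k + h - (v :: vs).length, wl G k (k + h - (v :: vs).length)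
            fun i => (v :: vs).getD i ((v :: vs).getLastD v)⟩) : Option (ColorType k))
          else some (Sum.inr (atp G (k + 1) fun i => (v :: vs).getD i ((v :: vs).getLastD v))) := rfl
    rw [hd, if_neg hNk]
    have : (fun i : Fin (k+1) => (v :: vs).getD i.1 ((v::vs).getLastD v)) = w := funext hw
    rw [this]
    rfl
  refine gen _ _ (u 0) _ List.ofFn_succ (by simp) ?_
  intro j
  rw [List.getD_eq_getElem _ _ (by simp only [List.length_ofFn]; exact j.2)]
  simp only [List.getElem_ofFn]

theorem chi_low (k h : ℕ) (n : ℕ) (hn1 : 1 ≤ n) (hn : n ≤ k) (u : Fin n → V) :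
    ∃ x, chiKH G k h (List.ofFn u) = some (Sum.inl x) := by
  obtain ⟨n, rfl⟩ : ∃ n', n = n' + 1 := ⟨n - 1, by omega⟩
  rw [List.ofFn_succ]
  simp only [chiKH, List.length_cons, List.length_ofFn]
  rw [if_pos hn]
  exact ⟨_, rfl⟩

/-- `χ` determines length and atomic type for lengths in `[1, k+1]`. -/
theorem chi_atp (k h : ℕ) (n m : ℕ) (hn1 : 1 ≤ n) (hn : n ≤ k+1) (hm1 : 1 ≤ m) (hm : m ≤ k+1)
    (u : Fin n → V) (v : Fin m → W)
    (hc : chiKH G k h (List.ofFn u) = chiKH H k h (List.ofFn v)) :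
      ∃ hnm : n = m, atp G n u = atp H n (v ∘ Fin.cast hnm) := by
  rcases Nat.lt_or_ge k n with hk | hk
  · obtain rfl : n = k + 1 := by omega
    rcases Nat.lt_or_ge k m with hk' | hk'
    · obtain rfl : m = k + 1 := by omega
      refine ⟨rfl, ?_⟩
      rw [chi_top, chi_top] at hc
      exact Sum.inr.inj (Option.some.inj hc)
    · obtain ⟨x, hx⟩ := chi_low H k h m hm1 hk' v
      rw [chi_top, hx] at hc
      cases hc
  · rcases Nat.lt_or_ge k m with hk' | hk'
    · obtain rfl : m = k + 1 := by omega
      obtain ⟨x, hx⟩ := chi_low G k h n hn1 hk u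
      rw [chi_top, hx] at hc
      cases hc
    · obtain ⟨rfl, h2⟩ := (chi_eq_iff G H k h n m hn1 hk hm1 hk' u v).1 hc
      refine ⟨rfl, ?_⟩
      have := wl_atp _ _ _ _ _ _ h2
      have := atp_comp _ _ _ _ this (Fin.castLE hk)
      have e : ∀ (X : Type) (u : Fin n → X), (fun j : Fin k => u ⟨min j.1 (n-1), by omega⟩) ∘ Fin.castLE hk = u := by
        intro X u; funext j; simp only [Function.comp]; congr 1; apply Fin.ext
        show min j.1 (n-1) = j.1
        omega
      rw [e, e] at this
      exact this

theorem chi_wl (k h : ℕ) (hk : 1 ≤ k) (u : Fin k → V) (v : Fin k → W) :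
    chiKH G k h (List.ofFn u) = chiKH H k h (List.ofFn v) ↔ wl G k h u = wl H k h v := by
  rw [chi_eq_iff G H k h k k hk le_rfl hk le_rfl]
  have h1 : k + h - k = h := by omega
  rw [h1]
  simp only [true_and]
  have : ∀ (X : Type) (u : Fin k → X), (fun j : Fin k => u ⟨min j.1 (k-1), by omega⟩) = u := by
    intro X u; funext j; congr 1; apply Fin.ext
    show min j.1 (k-1) = j.1
    omega
  rw [this, this]
end
end SWP

namespace SWP
set_option linter.unusedSectionVars false
set_option linter.unusedSimpArgs false
set_option linter.unnecessarySimpa false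
open scoped Classical

noncomputable instance instFintypeAtp (k : ℕ) : Fintype (AtpType k) :=
  inferInstanceAs (Fintype (Fin k → Fin k → Prop × Prop))

/-- injectivity indicator -/
noncomputable def inj {X : Type} {k : ℕ} (u : Fin k → X) : ℚ :=
  if Function.Injective u then 1 else 0

section
variable {ι : Type} {V : ι → Type} [∀ i, Fintype (V i)] (G : ∀ i, SimpleGraph (V i)) (k h : ℕ)

/-- closure class on all tuples -/
inductive RR : (∀ i, (Fin k → V i) → ℚ) → Prop
  | one : RR (fun _ _ => 1)
  | add {F F' : ∀ i, (Fin k → V i) → ℚ} : RR F → RR F' → RR (fun i u => F i u + F' i u)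
  | smul (c : ℚ) {F : ∀ i, (Fin k → V i) → ℚ} : RR F → RR (fun i u => c * F i u)
  | mul (g : WLColor k h → ℚ) {F : ∀ i, (Fin k → V i) → ℚ} : RR F →
      RR (fun i u => g (wl (G i) k h u) * F i u)
  | gen (κ : AtpType (k+1) → ℚ) (q : Fin k) {F : ∀ i, (Fin k → V i) → ℚ} : RR F →
      RR (fun i u => ∑ y, κ (atp (G i) (k+1) (Fin.snoc u y)) * F i (Function.update u q y))

/-- closure class on injective tuples -/
inductive RI : (∀ i, (Fin k → V i) → ℚ) → Prop
  | one : RI (fun _ u => inj u)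
  | add {F F' : ∀ i, (Fin k → V i) → ℚ} : RI F → RI F' → RI (fun i u => F i u + F' i u)
  | smul (c : ℚ) {F : ∀ i, (Fin k → V i) → ℚ} : RI F → RI (fun i u => c * F i u)
  | mul (g : WLColor k h → ℚ) {F : ∀ i, (Fin k → V i) → ℚ} : RI F →
      RI (fun i u => g (wl (G i) k h u) * F i u)
  | all (p : Fin k) {F : ∀ i, (Fin k → V i) → ℚ} : RI F →
      RI (fun i u => inj u * ∑ y, F i (Function.update u p y))
  | adj (p : Fin k) {F : ∀ i, (Fin k → V i) → ℚ} : RI F →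
      RI (fun i u => inj u * ∑ y, (if (G i).Adj (u p) y then 1 else 0) * F i (Function.update u p y))

variable {G k h}

theorem RI.zero : RI G k h (fun _ _ => 0) := by
  have := RI.smul (G := G) (h := h) (k := k) 0 RI.one
  simpa using this

theorem RR.zero : RR G k h (fun _ _ => 0) := by
  have := RR.smul (G := G) (h := h) (k := k) 0 RR.one
  simpa using this

theorem RI.sum {A : Type} (s : Finset A) (F : A → ∀ i, (Fin k → V i) → ℚ)
    (hF : ∀ a ∈ s, RI G k h (F a)) : RI G k h (fun i u => ∑ a ∈ s, F a i u) := by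
  induction s using Finset.induction_on with
  | empty => simpa using RI.zero
  | insert a s ha ih =>
    simp only [Finset.sum_insert ha]
    exact RI.add (hF a (by simp)) (ih fun b hb => hF b (by simp [hb]))

theorem RR.sum {A : Type} (s : Finset A) (F : A → ∀ i, (Fin k → V i) → ℚ)
    (hF : ∀ a ∈ s, RR G k h (F a)) : RR G k h (fun i u => ∑ a ∈ s, F a i u) := by
  induction s using Finset.induction_on with
  | empty => simpa using RR.zero
  | insert a s ha ih =>
    simp only [Finset.sum_insert ha]
    exact RR.add (hF a (by simp)) (ih fun b hb => hF b (by simp [hb]))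

/-- functions constant on classes factor -/
theorem exists_factor {X : Type*} {A : ι → Type*} (c : ∀ i, A i → X) (θ : ∀ i, A i → ℚ)
    (H : ∀ i j u v, c i u = c j v → θ i u = θ j v) : ∃ g : X → ℚ, ∀ i u, θ i u = g (c i u) := by
  refine ⟨fun x => if hx : ∃ p : Σ i, A i, c p.1 p.2 = x then θ hx.choose.1 hx.choose.2 else 0, ?_⟩
  intro i u
  have hx : ∃ p : Σ i, A i, c p.1 p.2 = c i u := ⟨⟨i, u⟩, rfl⟩
  simp only [dif_pos hx]
  exact H _ _ _ _ hx.choose_spec.symm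

theorem RI.mulc (θ : ∀ i, (Fin k → V i) → ℚ)
    (H : ∀ i j u v, wl (G i) k h u = wl (G j) k h v → θ i u = θ j v)
    {F : ∀ i, (Fin k → V i) → ℚ} (hF : RI G k h F) : RI G k h (fun i u => θ i u * F i u) := by
  obtain ⟨g, hg⟩ := exists_factor (fun i u => wl (G i) k h u) θ H
  simp only [hg]
  exact RI.mul g hF

theorem RR.mulc (θ : ∀ i, (Fin k → V i) → ℚ)
    (H : ∀ i j u v, wl (G i) k h u = wl (G j) k h v → θ i u = θ j v)
    {F : ∀ i, (Fin k → V i) → ℚ} (hF : RR G k h F) : RR G k h (fun i u => θ i u * F i u) := by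
  obtain ⟨g, hg⟩ := exists_factor (fun i u => wl (G i) k h u) θ H
  simp only [hg]
  exact RR.mul g hF

theorem inj_mul_inj {X : Type} {k : ℕ} (u : Fin k → X) : inj u * inj u = inj u := by
  unfold inj; split_ifs <;> simp

theorem RI.supp {F : ∀ i, (Fin k → V i) → ℚ} (hF : RI G k h F) :
    ∀ i u, inj u * F i u = F i u := by
  induction hF with
  | one => intro i u; exact inj_mul_inj u
  | add _ _ h1 h2 => intro i u; rw [mul_add, h1, h2]
  | smul c _ h1 => intro i u; rw [mul_left_comm, h1]
  | mul g _ h1 => intro i u; rw [mul_left_comm, h1]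
  | all p _ _ => intro i u; rw [← mul_assoc, inj_mul_inj]
  | adj p _ _ => intro i u; rw [← mul_assoc, inj_mul_inj]

theorem atp_snoc_det {V W : Type} (G : SimpleGraph V) (H : SimpleGraph W) (p : Fin k)
    (u : Fin k → V) (u' : Fin k → W) (y : V) (y' : W)
    (h1 : atp G k u = atp H k u')
    (h2 : atp G k (Function.update u p y) = atp H k (Function.update u' p y'))
    (h3 : G.Adj (u p) y ↔ H.Adj (u' p) y') (h4 : y ≠ u p) (h5 : y' ≠ u' p) :
    atp G (k+1) (Fin.snoc u y) = atp H (k+1) (Fin.snoc u' y') := by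
  have key : ∀ a : Fin k, ((u a = y) ↔ (u' a = y')) ∧ (G.Adj (u a) y ↔ H.Adj (u' a) y') := by
    intro a
    by_cases ha : a = p
    · subst ha
      exact ⟨by simp [h4.symm, h5.symm], h3⟩
    · have := congrFun (congrFun h2 a) p
      simp only [atp, Function.update_of_ne ha, Function.update_self, Prod.mk.injEq] at this
      exact ⟨iff_of_eq this.1, iff_of_eq this.2⟩
  funext i j
  refine Fin.lastCases ?_ (fun a => ?_) i <;> refine Fin.lastCases ?_ (fun b => ?_) j
  · simp [atp]
  · simp only [atp, Fin.snoc_last, Fin.snoc_castSucc]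
    exact Prod.ext (propext (by rw [eq_comm, (key b).1, eq_comm]))
      (propext (by rw [SimpleGraph.adj_comm, (key b).2, SimpleGraph.adj_comm]))
  · simp only [atp, Fin.snoc_last, Fin.snoc_castSucc]
    exact (Prod.ext (propext (key a).1) (propext (key a).2))
  · have := congrFun (congrFun h1 a) b
    simpa [atp] using this

theorem RI.gen (κ : AtpType (k+1) → ℚ) (p : Fin k) {F : ∀ i, (Fin k → V i) → ℚ} (hF : RI G k h F) :
    RI G k h (fun i u => inj u *
      ∑ y, κ (atp (G i) (k+1) (Fin.snoc u y)) * F i (Function.update u p y)) := by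
  obtain ⟨K, hK⟩ := exists_factor (ι := ι)
    (A := fun i => {x : (Fin k → V i) × V i // x.2 ≠ x.1 p})
    (fun i x => (atp (G i) k x.1.1, atp (G i) k (Function.update x.1.1 p x.1.2),
      (G i).Adj (x.1.1 p) x.1.2))
    (fun i x => κ (atp (G i) (k+1) (Fin.snoc x.1.1 x.1.2))) (by
      intro i j x y hxy
      simp only [Prod.mk.injEq] at hxy
      rw [atp_snoc_det (G i) (G j) p _ _ _ _ hxy.1 hxy.2.1 (iff_of_eq hxy.2.2) x.2 y.2])
  have hβ : ∀ (α : AtpType k) (e : Prop), RI G k h (fun i u => K (α, atp (G i) k u, e) * F i u) := by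
    intro α e
    refine RI.mulc (fun i u => K (α, atp (G i) k u, e)) ?_ hF
    intro i j u v huv
    rw [wl_atp _ _ _ _ _ _ huv]
  have hT := fun α => RI.adj p (hβ α True)
  have hE := fun α => RI.all p (hβ α False)
  have hA := fun α => RI.adj p (hβ α False)
  have hα := fun α : AtpType k => RI.mulc (G := G) (h := h) (fun i u => if atp (G i) k u = α then 1 else 0)
    (by intro i j u v huv; rw [wl_atp _ _ _ _ _ _ huv])
    (RI.add (hT α) (RI.add (hE α) (RI.smul (-1) (RI.add (hA α) (hβ α False)))))
  have h0 := RI.mulc (G := G) (h := h) (fun i u => κ (atp (G i) (k+1) (Fin.snoc u (u p))))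
    (by
      intro i j u v huv
      have := wl_atp _ _ _ _ _ _ huv
      have := atp_comp _ _ _ _ this (Fin.snoc id p : Fin (k+1) → Fin k)
      rw [Fin.comp_snoc, Fin.comp_snoc] at this
      rw [← Function.comp_id u, ← Function.comp_id v]
      exact congrArg κ this) hF
  have := RI.add h0 (RI.sum Finset.univ _ fun α _ => hα α)
  refine (congrArg _ ?_).mpr this
  funext i u
  have hs := hF.supp i u
  by_cases hu : Function.Injective u
  swap
  · have : F i u = 0 := by rw [← hs]; simp [inj, hu]
    simp [inj, hu, this]
  simp only [inj, hu, if_true, one_mul, ite_mul, zero_mul, Finset.sum_ite_eq, Finset.mem_univ]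
  have hsp : ∀ f : V i → ℚ, ∑ y, f y = f (u p) + ∑ y ∈ Finset.univ.erase (u p), f y := fun f =>
    (Finset.add_sum_erase _ _ (Finset.mem_univ _)).symm
  rw [hsp (fun y => κ (atp (G i) (k+1) (Fin.snoc u y)) * F i (Function.update u p y))]
  rw [Function.update_eq_self]
  congr 1
  rw [hsp, hsp, hsp]
  simp only [SimpleGraph.irrefl, if_false, Function.update_eq_self, zero_add]
  have : ∀ a b c d : ℚ, a + (b + c + -1 * (d + b)) = a + c - d := by intros; ring
  rw [this, ← Finset.sum_add_distrib, ← Finset.sum_sub_distrib]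
  refine Finset.sum_congr rfl fun y hy => ?_
  have hy' : y ≠ u p := (Finset.mem_erase.1 hy).1
  rw [hK i ⟨(u, y), hy'⟩]
  by_cases ha : (G i).Adj (u p) y
  · simp [ha]
  · simp [ha]

theorem RR.comp {F : ∀ i, (Fin k → V i) → ℚ} (hF : RR G k h F) :
    ∀ φ : Fin k → Fin k, RR G k h (fun i u => F i (u ∘ φ)) := by
  induction hF with
  | one => intro φ; exact RR.one
  | add _ _ h1 h2 => intro φ; exact RR.add (h1 φ) (h2 φ)
  | smul c _ h1 => intro φ; exact RR.smul c (h1 φ)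
  | mul g _ h1 =>
    intro φ
    exact RR.mulc (fun i u => g (wl (G i) k h (u ∘ φ)))
      (fun i j u v huv => congrArg g (wl_comp _ _ _ _ _ _ huv φ)) (h1 φ)
  | gen κ q _ h1 =>
    intro φ
    obtain ⟨q', hq⟩ := exists_unused φ q
    have := RR.gen (G := G) (h := h) (fun α => κ (fun a b =>
      α ((Fin.snoc (fun j => (φ j).castSucc) (Fin.last k) : Fin (k+1) → Fin (k+1)) a)
        ((Fin.snoc (fun j => (φ j).castSucc) (Fin.last k) : Fin (k+1) → Fin (k+1)) b))) q'
      (h1 (Function.update φ q q'))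
    simp only [update_comp_unused φ q q' hq, snoc_comp_lift]
    exact this

theorem RR.toRI {F : ∀ i, (Fin k → V i) → ℚ} (hF : RR G k h F) :
    ∀ φ : Fin k → Fin k, RI G k h (fun i u => inj u * F i (u ∘ φ)) := by
  induction hF with
  | one => intro φ; simpa using RI.one
  | add _ _ h1 h2 => intro φ; simp only [mul_add]; exact RI.add (h1 φ) (h2 φ)
  | smul c _ h1 => intro φ; simp only [mul_left_comm _ c]; exact RI.smul c (h1 φ)
  | mul g _ h1 =>
    intro φ
    have := RI.mulc (fun i u => g (wl (G i) k h (u ∘ φ)))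
      (fun i j u v huv => congrArg g (wl_comp _ _ _ _ _ _ huv φ)) (h1 φ)
    refine (congrArg _ ?_).mpr this
    funext i u; ring
  | @gen κ q F _ h1 =>
    intro φ
    obtain ⟨q', hq⟩ := exists_unused φ q
    set L : Fin (k+1) → Fin (k+1) := Fin.snoc (fun j => (φ j).castSucc) (Fin.last k)
    have hA := RI.gen (G := G) (h := h) (fun α => κ (fun a b => α (L a) (L b))) q'
      (h1 (Function.update φ q q'))
    have hB := RI.sum (Finset.univ.erase q') _ fun j _ =>
      RI.mulc (G := G) (h := h)
        (fun i u => κ (atp (G i) (k+1) ((Fin.snoc u (u j) : Fin (k+1) → V i) ∘ L)))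
        (by
          intro i i' u v huv
          have := wl_atp _ _ _ _ _ _ huv
          have := atp_comp _ _ _ _ this (Fin.snoc id j : Fin (k+1) → Fin k)
          rw [Fin.comp_snoc, Fin.comp_snoc] at this
          have := atp_comp _ _ _ _ this L
          exact congrArg κ this) (h1 (Function.update id q' j ∘ Function.update φ q q'))
    refine (congrArg _ ?_).mpr (RI.add hA hB)
    funext i u
    by_cases hu : Function.Injective u
    swap
    · simp [inj, hu]
    have hiu : inj u = 1 := by simp [inj, hu]
    simp only [hiu, one_mul]
    simp only [update_comp_unused φ q q' hq, snoc_comp_lift]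
    have hsplit : ∀ f : V i → ℚ, ∑ y, f y = (∑ y, inj (Function.update u q' y) * f y) +
        ∑ j ∈ Finset.univ.erase q', f (u j) := by
      intro f
      have : ∑ j ∈ Finset.univ.erase q', f (u j) = ∑ y ∈ (Finset.univ.erase q').image u, f y := by
        rw [Finset.sum_image (fun a _ b _ hab => hu hab)]
      rw [this]
      have h2 : ∀ y, inj (Function.update u q' y) * f y
          = if y ∈ (Finset.univ.erase q').image u then 0 else f y := by
        intro y
        by_cases hy : y ∈ (Finset.univ.erase q').image u
        · have : ¬ Function.Injective (Function.update u q' y) := by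
            intro hc
            obtain ⟨j, hj, rfl⟩ := Finset.mem_image.1 hy
            have hj' := (Finset.mem_erase.1 hj).1
            have := @hc j q' (by simp [Function.update_of_ne hj'])
            exact hj' this
          simp only [inj, this, hy, if_true, if_false, zero_mul]
        · have : Function.Injective (Function.update u q' y) := by
            intro a b hab
            by_cases ha : a = q' <;> by_cases hb : b = q'
            · rw [ha, hb]
            · subst ha
              rw [Function.update_self, Function.update_of_ne hb] at hab
              exact absurd (Finset.mem_image.2 ⟨b, by simp [hb], hab.symm⟩) hy
            · subst hb
              rw [Function.update_self, Function.update_of_ne ha] at hab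
              exact absurd (Finset.mem_image.2 ⟨a, by simp [ha], hab⟩) hy
            · rw [Function.update_of_ne hb, Function.update_of_ne ha] at hab
              exact hu hab
          simp only [inj, this, hy, if_true, if_false, one_mul]
      simp only [h2]
      rw [Finset.sum_ite, Finset.sum_const_zero, zero_add, add_comm, ← Finset.sum_filter_add_sum_filter_not Finset.univ (· ∈ (Finset.univ.erase q').image u)]
      congr 1
      refine Finset.sum_congr ?_ fun _ _ => rfl
      ext; simp
    rw [hsplit]
    congr 1
    · refine Finset.sum_congr rfl fun y _ => ?_
      rw [mul_left_comm]; rfl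
    · refine Finset.sum_congr rfl fun j _ => ?_
      congr 2
      rw [← Function.comp_assoc]
      congr 1
      rw [Function.comp_update, Function.comp_id]

variable (G k h)

/-- the common condition -/
structure Hub : Prop where
  card : ∀ i j, Fintype.card (V i) = Fintype.card (V j)
  atpm : ∀ i j ℓ, 1 ≤ ℓ → ℓ ≤ k → ∀ u : Fin ℓ → V i, Function.Injective u →
    ∃ v : Fin ℓ → V j, atp (G i) ℓ u = atp (G j) ℓ v
  sum : ∀ F, RI G k h F → ∀ i j, ∑ u, F i u = ∑ u, F j u

variable {G k h}

theorem sum_update {X : Type} [Fintype X] (f : (Fin k → X) → ℚ) (q : Fin k) :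
    ∑ u, ∑ y, f (Function.update u q y) = Fintype.card X * ∑ u, f u := by
  have hinv : Function.Involutive (fun x : (Fin k → X) × X => (Function.update x.1 q x.2, x.1 q)) := by
    intro x; simp
  have := Equiv.sum_comp hinv.toPerm (fun x => f x.1)
  rw [Fintype.sum_prod_type, Fintype.sum_prod_type] at this
  simp only [Finset.sum_const, Finset.card_univ, nsmul_eq_mul] at this
  rw [Finset.mul_sum, ← this]
  rfl

theorem RR.average {F : ∀ i, (Fin k → V i) → ℚ} (hF : RR G k h F) (S : Finset (Fin k)) :
    ∃ F' : ∀ i, (Fin k → V i) → ℚ, RR G k h F' ∧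
      (∀ i u v, (∀ j, j ∉ S → u j = v j) → F' i u = F' i v) ∧
      ∀ i, ∑ u, F' i u = (Fintype.card (V i) : ℚ)^S.card * ∑ u, F i u := by
  induction S using Finset.induction_on with
  | empty => exact ⟨F, hF, fun i u v huv => by rw [funext fun j => huv j (by simp)], by simp⟩
  | insert q S hq ih =>
    obtain ⟨F', h1, h2, h3⟩ := ih
    refine ⟨fun i u => ∑ y, F' i (Function.update u q y), ?_, ?_, ?_⟩
    · simpa using RR.gen (fun _ => 1) q h1
    · intro i u v huv
      refine Finset.sum_congr rfl fun y _ => h2 _ _ _ fun j hj => ?_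
      by_cases hjq : j = q
      · subst hjq; simp
      · rw [Function.update_of_ne hjq, Function.update_of_ne hjq]
        exact huv j (by simp [hjq, hj])
    · intro i
      rw [sum_update, h3, Finset.card_insert_of_notMem hq, pow_succ]; ring

theorem RR.iso {i j : ι} (e : V i ≃ V j) (he : ∀ x y, (G i).Adj x y ↔ (G j).Adj (e x) (e y))
    {F : ∀ i, (Fin k → V i) → ℚ} (hF : RR G k h F) : ∀ u, F i u = F j (e ∘ u) := by
  induction hF with
  | one => intro u; rfl
  | add _ _ h1 h2 => intro u; dsimp only; rw [h1, h2]
  | smul c _ h1 => intro u; dsimp only; rw [h1]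
  | mul g _ h1 => intro u; dsimp only; rw [h1, wl_iso (G i) (G j) e he]
  | gen κ q _ h1 =>
    intro u
    dsimp only
    rw [← Equiv.sum_comp e]
    refine Finset.sum_congr rfl fun y _ => ?_
    rw [h1, Function.comp_update, ← Fin.comp_snoc]
    congr 2
    funext a b
    simp only [atp, Function.comp, he, EmbeddingLike.apply_eq_iff_eq]

theorem Hub.rrsum (hk : 1 ≤ k) (H : Hub G k h) {F : ∀ i, (Fin k → V i) → ℚ} (hF : RR G k h F)
    (i j : ι) : ∑ u, F i u = ∑ u, F j u := by
  have hc := H.card i j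
  rcases Nat.lt_or_ge (Fintype.card (V i)) k with hn | hn
  · have : ∃ e : V i ≃ V j, ∀ x y, (G i).Adj x y ↔ (G j).Adj (e x) (e y) := by
      rcases Nat.eq_zero_or_pos (Fintype.card (V i)) with h0 | h0
      · refine ⟨Fintype.equivOfCardEq hc, ?_⟩
        intro x; exact ((Fintype.card_eq_zero_iff.1 h0).false x).elim
      · let e1 := (Fintype.equivFin (V i)).symm
        obtain ⟨v, hv⟩ := H.atpm i j _ h0 hn.le e1 e1.injective
        have hvi : Function.Injective v := by
          intro a b hab
          have := congrArg Prod.fst (congrFun (congrFun hv a) b)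
          simp only [atp] at this
          exact e1.injective (this.mpr hab)
        have hvb : Function.Bijective v :=
          (Fintype.bijective_iff_injective_and_card v).2 ⟨hvi, by simp [hc]⟩
        refine ⟨e1.symm.trans (Equiv.ofBijective v hvb), ?_⟩
        intro x y
        have := congrArg Prod.snd (congrFun (congrFun hv (e1.symm x)) (e1.symm y))
        simp only [atp, Equiv.apply_symm_apply] at this
        exact iff_of_eq this
    obtain ⟨e, he⟩ := this
    rw [← Equiv.sum_comp (Equiv.arrowCongr (Equiv.refl (Fin k)) e)]
    refine Finset.sum_congr rfl fun u _ => ?_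
    rw [hF.iso e he]; rfl
  · obtain ⟨F', h1, h2, h3⟩ := hF.average Finset.univ
    have h4 := H.sum _ (h1.toRI id) i j
    have h5 := H.sum _ RI.one i j
    have hpos : 0 < ∑ u : Fin k → V i, inj u := by
      have : Nonempty (Fin k ↪ V i) := Function.Embedding.nonempty_of_card_le (by simpa using hn)
      obtain ⟨f⟩ := this
      refine Finset.sum_pos' (fun u _ => by unfold inj; split_ifs <;> norm_num) ⟨f, Finset.mem_univ _, ?_⟩
      simp [inj, f.injective]
    have hconst : ∀ a, ∑ u : Fin k → V a, inj u * F' a (u ∘ id)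
        * (Fintype.card (V a) : ℚ)^k = (∑ u : Fin k → V a, inj u) * ∑ u, F' a u := by
      intro a
      rw [Finset.sum_mul]
      refine Finset.sum_congr rfl fun u _ => ?_
      have : ∀ v, F' a v = F' a u := fun v => h2 a v u (by simp)
      simp only [this, Finset.sum_const, Finset.card_univ, Function.comp_id]
      simp; ring
    have hi := hconst i
    have hj := hconst j
    rw [h3] at hi hj
    simp only [Finset.card_univ, Fintype.card_fin, ← Finset.sum_mul] at hi hj
    rw [← hc, ← h4, ← h5] at hj
    have hcp : (0:ℚ) < (Fintype.card (V i) : ℚ)^k := by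
      have : 0 < Fintype.card (V i) := by omega
      positivity
    have := hi.symm.trans hj
    have := mul_left_cancel₀ hpos.ne' this
    exact mul_left_cancel₀ hcp.ne' this
end
end SWP

namespace SWP
set_option linter.unusedSectionVars false
set_option linter.unusedSimpArgs false
set_option linter.unnecessarySimpa false
open scoped Classical

/-- finite Stone-Weierstrass over `ℚ` -/
theorem finite_sw {X : Type*} [Fintype X] (A : Subalgebra ℚ (X → ℚ)) (θ : X → ℚ)
    (H : ∀ x y, (∀ f ∈ A, f x = f y) → θ x = θ y) : θ ∈ A := by
  let R : X → X → Prop := fun x y => ∀ f ∈ A, f x = f y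
  have hsep : ∀ x y, ¬ R x y → ∃ f ∈ A, f x = 1 ∧ f y = 0 := by
    intro x y hxy
    simp only [R] at hxy
    push Not at hxy
    obtain ⟨f, hf, hne⟩ := hxy
    have hne' : f x - f y ≠ 0 := sub_ne_zero.2 hne
    refine ⟨(f x - f y)⁻¹ • (f - algebraMap ℚ (X → ℚ) (f y)), A.smul_mem (A.sub_mem hf (A.algebraMap_mem _)) _, ?_, ?_⟩
    · simp [hne']
    · simp
  choose! s hs1 hs2 hs3 using hsep
  let g : X → X → ℚ := fun x => ∏ y ∈ Finset.univ.filter (fun y => ¬ R x y), s x y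
  have hg : ∀ x, g x ∈ A := fun x => Subalgebra.prod_mem _ fun y hy =>
    hs1 x y (Finset.mem_filter.1 hy).2
  have hg1 : ∀ x z, R x z → g x z = 1 := by
    intro x z hxz
    simp only [g, Finset.prod_apply]
    refine Finset.prod_eq_one fun y hy => ?_
    have hy := (Finset.mem_filter.1 hy).2
    rw [← hxz _ (hs1 x y hy), hs2 x y hy]
  have hg0 : ∀ x z, ¬ R x z → g x z = 0 := by
    intro x z hxz
    simp only [g, Finset.prod_apply]
    exact Finset.prod_eq_zero (i := z) (by simp [hxz]) (hs3 x z hxz)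
  let N : X → ℚ := fun x => ∑ y, g x y
  have hNp : ∀ x, N x ≠ 0 := by
    intro x
    have : 0 < N x := by
      refine Finset.sum_pos' (fun y _ => ?_) ⟨x, Finset.mem_univ _, ?_⟩
      · by_cases hxy : R x y
        · rw [hg1 x y hxy]; norm_num
        · rw [hg0 x y hxy]
      · rw [hg1 x x (fun _ _ => rfl)]; norm_num
    exact this.ne'
  have : θ = ∑ x, (θ x * (N x)⁻¹) • g x := by
    funext z
    simp only [Finset.sum_apply, Pi.smul_apply, smul_eq_mul]
    have h1 : ∀ x, θ x * (N x)⁻¹ * g x z = θ z * (N z)⁻¹ * g z x := by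
      intro x
      by_cases hxz : R x z
      · have hzx : R z x := fun f hf => (hxz f hf).symm
        rw [H x z hxz, hg1 x z hxz, hg1 z x hzx]
        have : N x = N z := by
          refine Finset.sum_congr rfl fun y _ => ?_
          by_cases hxy : R x y
          · rw [hg1 x y hxy, hg1 z y fun f hf => (hzx f hf).trans (hxy f hf)]
          · rw [hg0 x y hxy, hg0 z y fun hzy => hxy fun f hf => (hxz f hf).trans (hzy f hf)]
        rw [this]
      · rw [hg0 x z hxz, hg0 z x fun hzx => hxz fun f hf => (hzx f hf).symm]; simp
    rw [Finset.sum_congr rfl fun x _ => h1 x, ← Finset.mul_sum]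
    have := hNp z
    change θ z = θ z * (N z)⁻¹ * N z
    field_simp
  rw [this]
  exact Subalgebra.sum_mem _ fun x _ => A.smul_mem (hg x) _

section
variable {ι : Type} [Fintype ι] {V : ι → Type} [∀ i, Fintype (V i)] {G : ∀ i, SimpleGraph (V i)} {k h : ℕ}

/-- clamping map -/
def clamp {k : ℕ} (ℓ : ℕ) (j : Fin k) : Fin k := ⟨min j.1 (ℓ-1), by omega⟩

theorem upd_clamp1 {X : Type} {ℓ : ℕ} (hℓ1 : 1 ≤ ℓ) (hℓ : ℓ < k) (u : Fin k → X) (y : X) :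
    (Function.update u ⟨ℓ, hℓ⟩ y ∘ clamp (ℓ+1)) ∘ clamp ℓ = u ∘ clamp ℓ := by
  funext j
  simp only [Function.comp]
  have : clamp (ℓ+1) (clamp ℓ j) = clamp ℓ j := by
    apply Fin.ext; simp only [clamp]; omega
  rw [this, Function.update_of_ne]
  intro hc; have := congrArg Fin.val hc; simp only [clamp] at this; omega

theorem upd_clamp2 {X : Type} {ℓ : ℕ} (hℓ1 : 1 ≤ ℓ) (hℓ : ℓ < k) (u : Fin k → X) (y : X) (p : Fin k) :
    (Function.update u ⟨ℓ, hℓ⟩ y ∘ clamp (ℓ+1)) ∘ Function.update (clamp ℓ) p ⟨ℓ, hℓ⟩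
      = Function.update (u ∘ clamp ℓ) p y := by
  rw [Function.comp_update, upd_clamp1 hℓ1 hℓ]
  congr 1
  simp only [Function.comp]
  have : clamp (ℓ+1) (⟨ℓ, hℓ⟩ : Fin k) = ⟨ℓ, hℓ⟩ := by
    apply Fin.ext; simp [clamp]
  rw [this, Function.update_self]

theorem upd_clamp3 {X : Type} {ℓ : ℕ} (hℓ1 : 1 ≤ ℓ) (hℓ : ℓ < k) (u : Fin k → X) (y : X) :
    (Function.update u ⟨ℓ, hℓ⟩ y ∘ clamp (ℓ+1)) ∘ (Fin.snoc (clamp ℓ) ⟨ℓ, hℓ⟩ : Fin (k+1) → Fin k)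
      = Fin.snoc (u ∘ clamp ℓ) y := by
  rw [Fin.comp_snoc, upd_clamp1 hℓ1 hℓ]
  congr 1
  simp only [Function.comp]
  have : clamp (ℓ+1) (⟨ℓ, hℓ⟩ : Fin k) = ⟨ℓ, hℓ⟩ := by
    apply Fin.ext; simp [clamp]
  rw [this, Function.update_self]

/-- dependence on the first `ℓ` coordinates only -/
def Dep (ℓ : ℕ) (F : ∀ i, (Fin k → V i) → ℚ) : Prop := ∀ i u, F i u = F i (u ∘ clamp ℓ)

theorem Dep.succ {ℓ : ℕ} {F : ∀ i, (Fin k → V i) → ℚ} (hF : Dep ℓ F) : Dep (ℓ+1) F := by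
  intro i u
  rw [hF i u, hF i (u ∘ clamp (ℓ+1)), Function.comp_assoc]
  congr 2
  funext j; apply Fin.ext; simp only [clamp, Function.comp]; omega

theorem Dep.upd {ℓ : ℕ} (hℓ1 : 1 ≤ ℓ) (hℓ : ℓ < k) {F : ∀ i, (Fin k → V i) → ℚ} (hF : Dep ℓ F) (i) (u : Fin k → V i) (y) :
    F i (Function.update u ⟨ℓ, hℓ⟩ y) = F i u := by
  rw [hF i u, hF]
  congr 1
  funext j
  simp only [Function.comp]
  rw [Function.update_of_ne]
  intro hc; have := congrArg Fin.val hc; simp only [clamp] at this; omega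

theorem core_mul (d : ℕ) : ∀ ℓ, 1 ≤ ℓ → ℓ + d = k → ∀ θ : ∀ i, (Fin k → V i) → ℚ,
    (∀ i j u v, wl (G i) k (k + h - ℓ) (u ∘ clamp ℓ) = wl (G j) k (k + h - ℓ) (v ∘ clamp ℓ) →
      θ i u = θ j v) → ∀ F, Dep ℓ F → RR G k h F → RR G k h (fun i u => θ i u * F i u) := by
  induction d with
  | zero =>
    intro ℓ h1 hd θ hθ F _ hF
    obtain rfl : ℓ = k := by omega
    refine RR.mulc θ ?_ hF
    intro i j u v huv
    apply hθ
    have : ℓ + h - ℓ = h := by omega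
    rw [this]
    exact wl_comp _ _ _ _ _ _ huv _
  | succ d ih =>
    intro ℓ h1 hd θ hθ
    have hℓ : ℓ < k := by omega
    obtain ⟨r, hr⟩ : ∃ r, k + h - ℓ = r + 1 := ⟨k + h - ℓ - 1, by omega⟩
    have hr' : k + h - (ℓ+1) = r := by omega
    -- algebra of multipliers
    let A : Subalgebra ℚ ((Σ i, Fin k → V i) → ℚ) :=
      { carrier := {f | Dep ℓ (fun i (u : Fin k → V i) => f ⟨i, u⟩) ∧ ∀ F, Dep ℓ F → RR G k h F →
            RR G k h (fun i u => f ⟨i, u⟩ * F i u)}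
        mul_mem' := by
          rintro f g ⟨hf1, hf2⟩ ⟨hg1, hg2⟩
          refine ⟨fun i u => ?_, fun F hF1 hF2 => ?_⟩
          · simp only [Pi.mul_apply]
            exact congrArg₂ _ (hf1 i u) (hg1 i u)
          · simp only [Pi.mul_apply, mul_assoc]
            exact hf2 _ (fun i u => congrArg₂ _ (hg1 i u) (hF1 i u)) (hg2 F hF1 hF2)
        add_mem' := by
          rintro f g ⟨hf1, hf2⟩ ⟨hg1, hg2⟩
          refine ⟨fun i u => ?_, fun F hF1 hF2 => ?_⟩
          · simp only [Pi.add_apply]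
            exact congrArg₂ _ (hf1 i u) (hg1 i u)
          · simp only [Pi.add_apply, add_mul]
            exact RR.add (hf2 F hF1 hF2) (hg2 F hF1 hF2)
        algebraMap_mem' := by
          intro c
          refine ⟨fun i u => rfl, fun F hF1 hF2 => RR.smul c hF2⟩ }
    have hN : ∀ b, (fun x : Σ i, Fin k → V i => ∑ y, if wl (G x.1) k r
        (Function.update x.2 ⟨ℓ, hℓ⟩ y ∘ clamp (ℓ+1)) = b then (1:ℚ) else 0) ∈ A := by
      intro b
      refine ⟨?_, ?_⟩
      · intro i u
        refine Finset.sum_congr rfl fun y _ => ?_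
        have : Function.update u ⟨ℓ, hℓ⟩ y ∘ clamp (ℓ+1)
            = Function.update (u ∘ clamp ℓ) ⟨ℓ, hℓ⟩ y ∘ clamp (ℓ+1) := by
          funext j
          simp only [Function.comp]
          by_cases hj : clamp (ℓ+1) j = ⟨ℓ, hℓ⟩
          · rw [hj]; simp
          · rw [Function.update_of_ne hj, Function.update_of_ne hj]
            simp only [Function.comp]
            congr 1
            apply Fin.ext
            have : (clamp (ℓ+1) j).1 ≠ ℓ := fun hc => hj (Fin.ext hc)
            simp only [clamp] at *
            omega
        rw [this]
      · intro F hF1 hF2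
        have hb := ih (ℓ+1) (by omega) (by omega)
          (fun i u => if wl (G i) k r (u ∘ clamp (ℓ+1)) = b then 1 else 0) (by
            intro i j u v huv
            rw [hr'] at huv
            rw [huv]) F hF1.succ hF2
        have := RR.gen (fun _ => 1) ⟨ℓ, hℓ⟩ hb
        refine (congrArg _ ?_).mpr this
        funext i u
        simp only [one_mul, hF1.upd h1 hℓ, Finset.sum_mul]
    have hθA : (fun x : Σ i, Fin k → V i => θ x.1 x.2) ∈ A := by
      apply finite_sw
      rintro ⟨i, u⟩ ⟨j, v⟩ huv
      apply hθ
      rw [hr]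
      have hcount : ∀ b, _ := fun b => huv _ (hN b)
      dsimp only at hcount
      have hm : (Finset.univ : Finset (V i)).val.map
          (fun y => wl (G i) k r (Function.update u ⟨ℓ, hℓ⟩ y ∘ clamp (ℓ+1)))
          = (Finset.univ : Finset (V j)).val.map
          (fun y => wl (G j) k r (Function.update v ⟨ℓ, hℓ⟩ y ∘ clamp (ℓ+1))) := by
        ext b
        have := hcount b
        rw [Finset.sum_boole, Finset.sum_boole] at this
        rw [Multiset.count_map, Multiset.count_map]
        have := Nat.cast_injective this
        simpa [Finset.card, eq_comm] using this
      obtain ⟨e, he⟩ := exists_equiv_of_map_eq _ _ hm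
      rw [wl_succ_iff]
      refine ⟨?_, e, fun y => ⟨?_, fun p => ?_⟩⟩
      · have := wl_comp _ _ _ _ _ _ (he (u ⟨ℓ, hℓ⟩)) (clamp ℓ)
        rwa [upd_clamp1 h1 hℓ, upd_clamp1 h1 hℓ] at this
      · have := wl_atp _ _ _ _ _ _ (he y)
        have := atp_comp _ _ _ _ this (Fin.snoc (clamp ℓ) ⟨ℓ, hℓ⟩ : Fin (k+1) → Fin k)
        rwa [upd_clamp3 h1 hℓ, upd_clamp3 h1 hℓ] at this
      · have := wl_comp _ _ _ _ _ _ (he y) (Function.update (clamp ℓ) p ⟨ℓ, hℓ⟩)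
        rwa [upd_clamp2 h1 hℓ, upd_clamp2 h1 hℓ] at this
    exact hθA.2

variable (G k h) in
/-- list functions representable on lists of length `ℓ` -/
def Rep (ℓ : ℕ) (Φ : ∀ i, List (V i) → ℚ) : Prop :=
  RR G k h (fun i u => Φ i ((List.ofFn u).take ℓ))

theorem take_ofFn {X : Type} {ℓ : ℕ} (hℓ : ℓ ≤ k) (u : Fin k → X) :
    (List.ofFn u).take ℓ = List.ofFn (fun j : Fin ℓ => u (Fin.castLE hℓ j)) := by
  apply List.ext_getElem
  · simp [hℓ]
  · intro n h1 h2
    simp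

theorem Rep.mul {ℓ : ℕ} (h1 : 1 ≤ ℓ) (hℓ : ℓ ≤ k) (θ : ∀ i, List (V i) → ℚ)
    (hθ : ∀ i j l l', l.length = ℓ → l'.length = ℓ → chiKH (G i) k h l = chiKH (G j) k h l' →
      θ i l = θ j l') {Φ : ∀ i, List (V i) → ℚ} (hΦ : Rep G k h ℓ Φ) :
    Rep G k h ℓ (fun i l => θ i l * Φ i l) := by
  refine core_mul (k - ℓ) ℓ h1 (by omega) (fun i u => θ i ((List.ofFn u).take ℓ)) ?_ _ ?_ hΦ
  · intro i j u v huv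
    apply hθ
    · simp [hℓ]
    · simp [hℓ]
    · rw [take_ofFn hℓ, take_ofFn hℓ, chi_eq_iff (G i) (G j) k h ℓ ℓ h1 hℓ h1 hℓ]
      exact ⟨rfl, huv⟩
  · intro i u
    dsimp only
    rw [take_ofFn hℓ, take_ofFn hℓ]
    congr 2
    funext j
    simp only [Function.comp]
    congr 1
    apply Fin.ext
    simp only [clamp, Fin.val_castLE]
    omega

theorem Rep.congr {ℓ : ℕ} (hℓ : ℓ ≤ k) {Φ Φ' : ∀ i, List (V i) → ℚ} (hΦ : Rep G k h ℓ Φ)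
    (H : ∀ i l, l.length = ℓ → Φ' i l = Φ i l) : Rep G k h ℓ Φ' := by
  unfold Rep
  refine (congrArg _ ?_).mpr hΦ
  funext i u
  exact H i _ (by simp [hℓ])

theorem Rep.add {ℓ : ℕ} {Φ Φ' : ∀ i, List (V i) → ℚ} (hΦ : Rep G k h ℓ Φ)
    (hΦ' : Rep G k h ℓ Φ') : Rep G k h ℓ (fun i l => Φ i l + Φ' i l) := RR.add hΦ hΦ'

theorem Rep.zero {ℓ : ℕ} : Rep G k h ℓ (fun _ _ => 0) := RR.zero
theorem Rep.one {ℓ : ℕ} : Rep G k h ℓ (fun _ _ => 1) := RR.one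

theorem Rep.sum {ℓ : ℕ} {A : Type} (s : Finset A) (Φ : A → ∀ i, List (V i) → ℚ)
    (hΦ : ∀ a ∈ s, Rep G k h ℓ (Φ a)) : Rep G k h ℓ (fun i l => ∑ a ∈ s, Φ a i l) :=
  RR.sum s _ hΦ

theorem Rep.erase {ℓ : ℕ} (hℓ : ℓ + 1 ≤ k) (p : ℕ) (hp : p ≤ ℓ) {Φ : ∀ i, List (V i) → ℚ}
    (hΦ : Rep G k h ℓ Φ) : Rep G k h (ℓ+1) (fun i l => Φ i (l.eraseIdx p)) := by
  have := RR.comp hΦ (fun j : Fin k => if j.1 < p then j else ⟨min (j.1+1) (k-1), by omega⟩)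
  unfold Rep
  refine (congrArg _ ?_).mpr this
  funext i u
  dsimp only
  congr 1
  apply List.ext_getElem
  · rw [List.length_eraseIdx]
    simp only [List.length_take, List.length_ofFn]
    rw [if_pos (by omega)]; omega
  · intro n h1 h2
    simp only [List.length_take, List.length_ofFn] at h2
    rw [List.getElem_eraseIdx]
    simp only [List.getElem_take, List.getElem_ofFn, Function.comp]
    by_cases hn : n < p
    · simp [hn]
    · simp only [hn, dite_false, if_false]
      congr 1
      apply Fin.ext
      simp only
      omega

/-- insertion index map -/
def insMap {k : ℕ} (p ℓ : ℕ) (hℓ : ℓ < k) (j : Fin k) : Fin k :=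
  if j.1 < p then j else if j.1 = p then ⟨ℓ, hℓ⟩ else ⟨j.1 - 1, by omega⟩

theorem insertIdx_take {X : Type} {ℓ : ℕ} (hℓ : ℓ < k) (p : ℕ) (hp : p ≤ ℓ) (u : Fin k → X) (y : X) :
    ((List.ofFn u).take ℓ).insertIdx p y =
      (List.ofFn (Function.update u ⟨ℓ, hℓ⟩ y ∘ insMap p ℓ hℓ)).take (ℓ+1) := by
  apply List.ext_getElem
  · rw [List.length_insertIdx_of_le_length (by simp; omega)]
    simp; omega
  · intro n h1 h2
    simp only [List.length_take, List.length_ofFn] at h2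
    rw [List.getElem_insertIdx]
    simp only [List.getElem_take, List.getElem_ofFn, Function.comp, insMap]
    by_cases hn : n < p
    · simp only [hn, dite_true, if_true]
      rw [Function.update_of_ne]
      intro hc; have := congrArg Fin.val hc; simp only at this; omega
    · simp only [hn, dite_false, if_false]
      by_cases hn2 : n = p
      · simp [hn2]
      · simp only [hn2, dite_false, if_false]
        rw [Function.update_of_ne]
        intro hc; have := congrArg Fin.val hc; simp only at this; omega

theorem Rep.ins {ℓ : ℕ} (hℓ : ℓ < k) (p : ℕ) (hp : p ≤ ℓ) {Φ : ∀ i, List (V i) → ℚ}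
    (hΦ : Rep G k h (ℓ+1) Φ) : Rep G k h ℓ (fun i l => ∑ y, Φ i (l.insertIdx p y)) := by
  have := RR.gen (fun _ => 1) ⟨ℓ, hℓ⟩ (RR.comp hΦ (insMap p ℓ hℓ))
  unfold Rep
  refine (congrArg _ ?_).mpr this
  funext i u
  refine Finset.sum_congr rfl fun y _ => ?_
  rw [insertIdx_take hℓ p hp, one_mul]

theorem Rep.set {ℓ : ℕ} (hℓ : ℓ ≤ k) (p : ℕ) (hp : p < ℓ) (τ : AtpType 2) {Φ : ∀ i, List (V i) → ℚ}
    (hΦ : Rep G k h ℓ Φ) : Rep G k h ℓ (fun i l => ∑ y,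
      (if ∃ x, l[p]? = some x ∧ atp (G i) 2 ![x, y] = τ then 1 else 0) * Φ i (l.set p y)) := by
  have := RR.gen (fun α => if (fun a b => α ((![(⟨p, by omega⟩ : Fin (k+1)), Fin.last k] : Fin 2 → Fin (k+1)) a)
      ((![(⟨p, by omega⟩ : Fin (k+1)), Fin.last k] : Fin 2 → Fin (k+1)) b)) = τ then 1 else 0) ⟨p, by omega⟩ hΦ
  unfold Rep
  refine (congrArg _ ?_).mpr this
  funext i u
  refine Finset.sum_congr rfl fun y _ => ?_
  congr 1
  · have h1 : ((List.ofFn u).take ℓ)[p]? = some (u ⟨p, by omega⟩) := by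
      rw [List.getElem?_eq_getElem (by simp; omega)]
      simp
    rw [h1]
    have h2 : (fun a b => atp (G i) (k + 1) (Fin.snoc u y) ((![(⟨p, by omega⟩ : Fin (k+1)), Fin.last k] : Fin 2 → Fin (k+1)) a)
      ((![(⟨p, by omega⟩ : Fin (k+1)), Fin.last k] : Fin 2 → Fin (k+1)) b)) = atp (G i) 2 ![u ⟨p, by omega⟩, y] := by
      have h3 : (![u ⟨p, by omega⟩, y] : Fin 2 → V i) = (Fin.snoc u y : Fin (k+1) → V i) ∘ (![(⟨p, by omega⟩ : Fin (k+1)), Fin.last k] : Fin 2 → Fin (k+1)) := by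
        funext a
        fin_cases a
        · exact (Fin.snoc_castSucc (α := fun _ => V i) y u ⟨p, by omega⟩).symm
        · simp
      rw [h3]; rfl
    rw [h2]
    refine if_congr ?_ rfl rfl
    simp
    exact Iff.rfl
  · congr 1
    apply List.ext_getElem
    · simp
    · intro n h1 h2
      rw [List.getElem_set]
      simp only [List.getElem_take, List.getElem_ofFn]
      by_cases hn : p = n
      · subst hn; simp
      · rw [if_neg hn, Function.update_of_ne]
        intro hc; have := congrArg Fin.val hc; simp only at this; omega

theorem Rep.total (hk : 1 ≤ k) (H : Hub G k h) {ℓ : ℕ} (hℓ1 : 1 ≤ ℓ) (hℓ : ℓ ≤ k) {Φ : ∀ i, List (V i) → ℚ}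
    (hΦ : Rep G k h ℓ Φ) (i j : ι) :
    ∑ u : Fin ℓ → V i, Φ i (List.ofFn u) = ∑ u : Fin ℓ → V j, Φ j (List.ofFn u) := by
  have h1 := H.rrsum hk hΦ i j
  have h2 : ∀ i, ∑ u : Fin k → V i, Φ i ((List.ofFn u).take ℓ) =
      (Fintype.card (V i) : ℚ)^(k-ℓ) * ∑ u : Fin ℓ → V i, Φ i (List.ofFn u) := by
    intro i
    clear h1 hΦ H hk
    obtain ⟨d, rfl⟩ : ∃ d, k = ℓ + d := ⟨k - ℓ, by omega⟩
    rw [← Equiv.sum_comp (Fin.appendEquiv ℓ d), Fintype.sum_prod_type, Finset.mul_sum]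
    refine Finset.sum_congr rfl fun u _ => ?_
    have : ∀ v : Fin d → V i, (List.ofFn (Fin.appendEquiv ℓ d (u, v))).take ℓ = List.ofFn u := by
      intro v
      rw [take_ofFn hℓ]
      congr 1
      funext a
      exact Fin.append_left u v a
    simp [this]
  have hc := H.card i j
  rw [h2, h2, ← hc] at h1
  rcases Nat.eq_zero_or_pos (Fintype.card (V i)) with h0 | h0
  · have hi := Fintype.card_eq_zero_iff.1 h0
    have hj := Fintype.card_eq_zero_iff.1 (hc ▸ h0)
    have : IsEmpty (Fin ℓ → V i) := ⟨fun u => hi.false (u ⟨0, hℓ1⟩)⟩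
    have : IsEmpty (Fin ℓ → V j) := ⟨fun u => hj.false (u ⟨0, hℓ1⟩)⟩
    simp
  · refine mul_left_cancel₀ ?_ h1
    positivity
end
end SWP

namespace SWP
set_option linter.unusedSectionVars false
set_option linter.unusedSimpArgs false
set_option linter.unnecessarySimpa false
open scoped Classical

section
variable {ι : Type} [Fintype ι] {V : ι → Type} [∀ i, Fintype (V i)] (G : ∀ i, SimpleGraph (V i)) (k h : ℕ)

/-- counts of words in the refinement -/
noncomputable def fsw (t : ℕ) (c : List (Option (ColorType k))) (i : ι) (l : List (V i)) : ℚ :=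
  ((swRef (G i) k h t l).count c : ℕ)

theorem count_map_append {X : Type} [DecidableEq (List X)] (s : Multiset (List X)) (c : List X) (x y : X) :
    (s.map (fun c => c ++ [y])).count (c ++ [x]) = if y = x then s.count c else 0 := by
  split_ifs with hxy
  · subst hxy
    exact Multiset.count_map_eq_count' (fun c => c ++ [y]) s (List.append_left_injective [y]) c
  · rw [Multiset.count_eq_zero]
    intro hc
    obtain ⟨d, _, hd⟩ := Multiset.mem_map.1 hc
    have := List.append_inj' hd rfl
    exact hxy (by simpa using this.2)

theorem count_map_append_nil {X : Type} [DecidableEq (List X)] (s : Multiset (List X)) (y : X) :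
    (s.map (fun c => c ++ [y])).count [] = 0 := by
  rw [Multiset.count_eq_zero]
  intro hc
  obtain ⟨d, _, hd⟩ := Multiset.mem_map.1 hc
  simp at hd

theorem fsw_succ (t : ℕ) (c : List (Option (ColorType k))) (x) (i : ι) (l : List (V i)) :
    fsw G k h (t+1) (c ++ [x]) i l = (if chiKH (G i) k h l = x then 1 else 0) *
      ((if 1 < l.length then fsw G k h t c i l.dropLast else 0) +
       (if l.length ≤ k then ∑ p ∈ Finset.range (l.length + 1), ∑ y, fsw G k h t c i (l.insertIdx p y)
        else 0)) := by
  unfold fsw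
  rw [swRef, Multiset.count_add]
  by_cases hx : chiKH (G i) k h l = x
  · subst hx
    rw [if_pos rfl]
    split_ifs <;> simp [Multiset.count_sum', count_map_append]
  · split_ifs <;> simp [Multiset.count_sum', count_map_append, hx]

theorem fsw_succ_nil (t : ℕ) (i : ι) (l : List (V i)) : fsw G k h (t+1) [] i l = 0 := by
  unfold fsw
  rw [swRef, Multiset.count_add]
  split_ifs <;> simp [Multiset.count_sum', count_map_append_nil]

theorem fsw_zero (c : List (Option (ColorType k))) (i : ι) (l : List (V i)) :
    fsw G k h 0 c i l = if l.length = 1 ∧ c = [chiKH (G i) k h l] then 1 else 0 := by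
  unfold fsw
  rw [swRef]
  by_cases h1 : l.length = 1
  · simp [h1, Multiset.count_singleton]
  · simp [h1]

variable {G k h}

theorem insert_ofFn {X : Type} (u : Fin k → X) (y : X) (p : ℕ) (hp : p ≤ k) :
    (List.ofFn u).insertIdx p y = List.ofFn ((Fin.snoc u y : Fin (k+1) → X) ∘ insMap p k (Nat.lt_succ_self k)) := by
  have := insertIdx_take (Nat.lt_succ_self k) p hp (Fin.snoc u y : Fin (k+1) → X) y
  rw [List.take_of_length_le (l := List.ofFn (_ ∘ insMap p k _)) (by simp)] at this
  rw [take_ofFn (Nat.le_succ k)] at this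
  have h2 : (fun j : Fin k => (Fin.snoc u y : Fin (k+1) → X) (Fin.castLE (Nat.le_succ k) j)) = u := by
    funext j
    exact Fin.snoc_castSucc (α := fun _ => X) y u j
  rw [h2] at this
  rw [this]
  congr 2
  have : (⟨k, Nat.lt_succ_self k⟩ : Fin (k+1)) = Fin.last k := rfl
  rw [this]
  conv_rhs => rw [← Function.update_eq_self (Fin.last k) (Fin.snoc u y : Fin (k+1) → X)]
  rw [Fin.snoc_last]

theorem dropLast_ofFn {X : Type} (w : Fin (k+1) → X) :
    (List.ofFn w).dropLast = List.ofFn (w ∘ Fin.castSucc) := by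
  rw [List.ofFn_succ']
  simp
  rfl

theorem ins_cast_lt {X : Type} (u : Fin k → X) (y : X) (p : ℕ) (hp : p < k) :
    ((Fin.snoc u y : Fin (k+1) → X) ∘ insMap p k (Nat.lt_succ_self k)) ∘ Fin.castSucc
      = Function.update u ⟨k-1, by omega⟩ y ∘ insMap p (k-1) (by omega) := by
  funext j
  simp only [Function.comp, insMap, Fin.val_castSucc]
  by_cases h1 : j.1 < p
  · simp only [h1, if_true, Fin.snoc_castSucc]
    rw [Function.update_of_ne]
    intro hc; have := congrArg Fin.val hc; simp only at this; omega
  · by_cases h2 : j.1 = p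
    · simp only [h1, h2, if_false, if_true, lt_irrefl, Function.update_self]
      exact Fin.snoc_last (α := fun _ => X) y u
    · simp only [h1, h2, if_false]
      rw [Function.update_of_ne]
      · exact Fin.snoc_castSucc (α := fun _ => X) y u ⟨j.1 - 1, by omega⟩
      intro hc; have := congrArg Fin.val hc; simp only at this; omega

theorem ins_cast_eq {X : Type} (u : Fin k → X) (y : X) :
    ((Fin.snoc u y : Fin (k+1) → X) ∘ insMap k k (Nat.lt_succ_self k)) ∘ Fin.castSucc = u := by
  funext j
  simp only [Function.comp, insMap, Fin.val_castSucc, j.2, if_true, Fin.snoc_castSucc]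

theorem chi_mult (x : Option (ColorType k)) : ∀ i j (l : List (V i)) (l' : List (V j)),
    chiKH (G i) k h l = chiKH (G j) k h l' →
    (if chiKH (G i) k h l = x then (1:ℚ) else 0) = (if chiKH (G j) k h l' = x then (1:ℚ) else 0) := by
  intro i j l l' hl
  rw [hl]

theorem sw_rep (hk : 1 ≤ k) (hh : 1 ≤ h) (t : ℕ) : ∀ c ℓ, 1 ≤ ℓ → ℓ ≤ k → Rep G k h ℓ (fsw G k h t c) := by
  induction t using Nat.strong_induction_on with
  | _ t ih =>
  intro c ℓ h1 hℓ
  rcases t with _ | t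
  · by_cases hℓ1 : ℓ = 1
    · have := Rep.mul h1 hℓ (fun i l => if c = [chiKH (G i) k h l] then 1 else 0)
        (by intro i j l l' _ _ hl; rw [hl]) (Rep.one (G := G) (h := h))
      refine this.congr hℓ fun i l hl => ?_
      rw [fsw_zero]; simp [hl, hℓ1]
    · refine Rep.zero.congr hℓ fun i l hl => ?_
      rw [fsw_zero]; simp [hl, hℓ1]
  · rcases List.eq_nil_or_concat c with rfl | ⟨c, x, rfl⟩
    · refine Rep.zero.congr hℓ fun i l hl => ?_
      rw [fsw_succ_nil]
    rw [List.concat_eq_append]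
    have hA : Rep G k h ℓ (fun i l => if 1 < l.length then fsw G k h t c i l.dropLast else 0) := by
      rcases Nat.lt_or_ge 1 ℓ with h2 | h2
      · obtain ⟨ℓ, rfl⟩ : ∃ m, ℓ = m + 1 := ⟨ℓ - 1, by omega⟩
        refine (Rep.erase hℓ ℓ le_rfl (ih t (by omega) c ℓ (by omega) (by omega))).congr hℓ fun i l hl => ?_
        rw [if_pos (by omega), List.dropLast_eq_eraseIdx (i := ℓ) (by omega)]
      · refine Rep.zero.congr hℓ fun i l hl => ?_
        rw [if_neg (by omega)]
    have hB : Rep G k h ℓ (fun i l => if l.length ≤ k then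
        ∑ p ∈ Finset.range (l.length + 1), ∑ y, fsw G k h t c i (l.insertIdx p y) else 0) := by
      rcases Nat.lt_or_ge ℓ k with h2 | h2
      · refine (Rep.sum (Finset.range (ℓ+1)) _ fun p hp => Rep.ins h2 p
          (by have := Finset.mem_range.1 hp; omega) (ih t (by omega) c (ℓ+1) (by omega) (by omega))).congr hℓ fun i l hl => ?_
        rw [hl, if_pos hℓ]
      · obtain rfl : ℓ = k := by omega
        rcases t with _ | t
        · refine Rep.zero.congr hℓ fun i l hl => ?_
          rw [if_pos (by omega)]
          refine Finset.sum_eq_zero fun p hp => Finset.sum_eq_zero fun y _ => ?_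
          have := Finset.mem_range.1 hp
          rw [fsw_zero, if_neg]
          rw [List.length_insertIdx_of_le_length (by omega)]
          omega
        rcases List.eq_nil_or_concat c with rfl | ⟨c, x', rfl⟩
        · refine Rep.zero.congr hℓ fun i l hl => ?_
          simp [fsw_succ_nil]
        rw [List.concat_eq_append]
        have hc : RR G ℓ h (fun i u => fsw G ℓ h t c i (List.ofFn u)) := by
          have := ih t (by omega) c ℓ h1 hℓ
          unfold Rep at this
          have h3 : ∀ i (u : Fin ℓ → V i), (List.ofFn u).take ℓ = List.ofFn u := fun i u =>
            List.take_of_length_le (by simp)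
          simpa only [h3] using this
        have key : ∀ p ∈ Finset.range (ℓ+1), RR G ℓ h (fun i u => ∑ y,
            (if (some (Sum.inr (atp (G i) (ℓ+1) ((Fin.snoc u y : Fin (ℓ+1) → V i) ∘ insMap p ℓ (Nat.lt_succ_self ℓ)))) : Option (ColorType ℓ)) = x' then 1 else 0)
            * fsw G ℓ h t c i (List.ofFn (((Fin.snoc u y : Fin (ℓ+1) → V i) ∘ insMap p ℓ (Nat.lt_succ_self ℓ)) ∘ Fin.castSucc))) := by
          intro p hp
          have hp := Finset.mem_range.1 hp
          rcases Nat.lt_or_ge p ℓ with h4 | h4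
          · simp only [ins_cast_lt _ _ p h4]
            have := RR.gen (fun α => if (some (Sum.inr (fun a b => α (insMap p ℓ (Nat.lt_succ_self ℓ) a) (insMap p ℓ (Nat.lt_succ_self ℓ) b))) : Option (ColorType ℓ)) = x' then 1 else 0) ⟨ℓ-1, by omega⟩ (RR.comp hc (insMap p (ℓ-1) (by omega)))
            exact this
          · obtain rfl : p = ℓ := by omega
            simp only [ins_cast_eq, ← Finset.sum_mul]
            refine RR.mulc _ ?_ hc
            intro i j u v huv
            obtain ⟨h', rfl⟩ : ∃ h', h = h' + 1 := ⟨h - 1, by omega⟩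
            obtain ⟨_, e, he⟩ := (wl_succ_iff _ _ _ _ _ _).1 huv
            rw [← Equiv.sum_comp e]
            refine Finset.sum_congr rfl fun y _ => ?_
            rw [atp_comp _ _ _ _ (he y).1]
        have := RR.sum _ _ key
        unfold Rep
        refine (congrArg _ ?_).mpr this
        funext i u
        dsimp only
        rw [List.take_of_length_le (l := List.ofFn u) (by simp), List.length_ofFn, if_pos le_rfl]
        refine Finset.sum_congr rfl fun p hp => Finset.sum_congr rfl fun y _ => ?_
        have hp := Finset.mem_range.1 hp
        rw [insert_ofFn u y p (by omega), fsw_succ, chi_top, dropLast_ofFn]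
        simp only [List.length_ofFn]
        rw [if_pos (show 1 < ℓ + 1 by omega), if_neg (show ¬ ℓ + 1 ≤ ℓ by omega), add_zero]
        rfl
    refine (Rep.mul h1 hℓ _ (fun i j l l' _ _ hl => chi_mult x i j l l' hl) (hA.add hB)).congr hℓ fun i l hl => ?_
    rw [fsw_succ]

theorem count_SwT (t : ℕ) (c) (i : ι) : ((SwT (G i) k h t).count c : ℚ) =
    ∑ n ∈ Finset.range k, ∑ u : Fin (n+1) → V i, fsw G k h t c i (List.ofFn u) := by
  unfold SwT fsw
  simp [Multiset.count_sum']

theorem Hub.sw (hk : 1 ≤ k) (hh : 1 ≤ h) (H : Hub G k h) (t : ℕ) (i j : ι) :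
    SwT (G i) k h t = SwT (G j) k h t := by
  ext c
  have : ((SwT (G i) k h t).count c : ℚ) = (SwT (G j) k h t).count c := by
    rw [count_SwT, count_SwT]
    refine Finset.sum_congr rfl fun n hn => ?_
    have := Finset.mem_range.1 hn
    exact Rep.total hk H (by omega) (by omega) (sw_rep hk hh t c (n+1) (by omega) (by omega)) i j
  exact_mod_cast this
end
end SWP

namespace SWP
set_option linter.unusedSectionVars false
set_option linter.unusedSimpArgs false
set_option linter.unnecessarySimpa false
open scoped Classical

section
variable {X : Type} [Fintype X] {k h : ℕ}

theorem qList_len (q : QIdx X k) : (qList q).length = q.1.1 + 1 := by simp [qList]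

theorem qList_nodup (q : QIdx X k) : (qList q).Nodup := List.nodup_ofFn.2 q.2.injective

theorem qList_inj : Function.Injective (qList : QIdx X k → List X) := by
  rintro ⟨⟨n, hn⟩, f⟩ ⟨⟨m, hm⟩, g⟩ hfg
  have hl : n = m := by
    have := congrArg List.length hfg
    simpa [qList] using this
  subst hl
  have := List.ofFn_injective hfg
  have : f = g := DFunLike.coe_injective this
  rw [this]

theorem qList_surj (l : List X) (h1 : l ≠ []) (h2 : l.Nodup) (h3 : l.length ≤ k) :
    ∃ q : QIdx X k, qList q = l := by
  have h4 : 0 < l.length := List.length_pos_iff.2 h1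
  refine ⟨⟨⟨l.length - 1, by omega⟩, ⟨fun j => l.get ⟨j.1, by have := j.2; simp only at this; omega⟩, ?_⟩⟩, ?_⟩
  · intro a b hab
    have := List.nodup_iff_injective_get.1 h2 hab
    exact Fin.ext (Fin.mk.inj_iff.1 this)
  · apply List.ext_getElem
    · simp [qList]; omega
    · intro n h5 h6
      simp only [qList, List.getElem_ofFn]
      rfl

/-- extension of a vector on states to all lists -/
noncomputable def ext (f : QIdx X k → ℚ) (l : List X) : ℚ := ∑ q, if qList q = l then f q else 0

theorem ext_qList (f : QIdx X k → ℚ) (q) : ext f (qList q) = f q := by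
  unfold ext
  rw [Finset.sum_eq_single q]
  · simp
  · intro b _ hb
    rw [if_neg fun hc => hb (qList_inj hc)]
  · simp

theorem ext_zero (f : QIdx X k → ℚ) (l : List X) (hl : ∀ q : QIdx X k, qList q ≠ l) : ext f l = 0 := by
  unfold ext
  exact Finset.sum_eq_zero fun q _ => by rw [if_neg (hl q)]

theorem ext_of (f : QIdx X k → ℚ) (Ψ : List X → ℚ) (H : ∀ q, f q = Ψ (qList q)) (l : List X)
    (h1 : 1 ≤ l.length) (h2 : l.length ≤ k) : ext f l = (if l.Nodup then 1 else 0) * Ψ l := by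
  by_cases hn : l.Nodup
  · obtain ⟨q, rfl⟩ := qList_surj (k := k) l (List.length_pos_iff.1 h1) hn h2
    rw [ext_qList, H]; simp [hn]
  · rw [ext_zero]
    · simp [hn]
    · intro q hq; exact hn (hq ▸ qList_nodup q)

theorem sum_ext (f : QIdx X k → ℚ) :
    ∑ q, f q = ∑ n ∈ Finset.range k, ∑ u : Fin (n+1) → X, ext f (List.ofFn u) := by
  have : ∀ q : QIdx X k, f q = ∑ n ∈ Finset.range k, ∑ u : Fin (n+1) → X,
      if qList q = List.ofFn u then f q else 0 := by
    rintro ⟨⟨m, hm⟩, g⟩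
    rw [Finset.sum_eq_single m]
    · rw [Finset.sum_eq_single (g : Fin (m+1) → X)]
      · exact (if_pos rfl).symm
      · intro u _ hu
        rw [if_neg]
        intro hc
        exact hu (List.ofFn_injective hc).symm
      · simp
    · intro n _ hn
      refine Finset.sum_eq_zero fun u _ => ?_
      rw [if_neg]
      intro hc
      have := congrArg List.length hc
      simp [qList] at this
      exact hn this.symm
    · intro hc; exact absurd (Finset.mem_range.2 hm) hc
  rw [Finset.sum_congr rfl fun q _ => this q, Finset.sum_comm]
  refine Finset.sum_congr rfl fun n _ => ?_
  rw [Finset.sum_comm]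
  rfl

variable (G : SimpleGraph X)

theorem P_mulVec (a : ColorType k) (f : QIdx X k → ℚ) (q) : (Pmat G k h a).mulVec f q =
    (if chiKH G k h (qList q) = some a then 1 else 0) * f q := by
  unfold Pmat Matrix.mulVec dotProduct
  simp only [Matrix.of_apply, ite_mul, one_mul, zero_mul]
  rw [Finset.sum_eq_single q]
  · simp
  · intro b _ hb
    rw [if_neg]; rintro ⟨rfl, _⟩; exact hb rfl
  · simp

theorem DM_mulVec (p : Fin k) (f : QIdx X k → ℚ) (q) : (DmatM X k p).mulVec f q =
    if p.1 < (qList q).length then ext f ((qList q).eraseIdx p.1) else 0 := by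
  unfold DmatM Matrix.mulVec dotProduct
  simp only [Matrix.of_apply, ite_mul, one_mul, zero_mul]
  split_ifs with h1
  · unfold ext
    refine Finset.sum_congr rfl fun v _ => ?_
    refine if_congr ?_ rfl rfl
    simp [h1, eq_comm]
  · simp [h1]

theorem DP_mulVec (p : Fin k) (f : QIdx X k → ℚ) (q) : (DmatP X k p).mulVec f q =
    if p.1 ≤ (qList q).length then ∑ y, ext f ((qList q).insertIdx p.1 y) else 0 := by
  unfold DmatP Matrix.mulVec dotProduct
  simp only [Matrix.of_apply, ite_mul, one_mul, zero_mul]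
  split_ifs with h1
  · unfold ext
    rw [Finset.sum_comm]
    refine Finset.sum_congr rfl fun v _ => ?_
    by_cases hv : p.1 < (qList v).length ∧ qList q = (qList v).eraseIdx p.1
    · rw [if_pos hv, Finset.sum_eq_single ((qList v)[p.1]'hv.1)]
      · rw [if_pos]
        have h9 := List.insertIdx_eraseIdx_getElem hv.1
        exact h9.symm.trans (congrArg (fun l => List.insertIdx l p.1 ((qList v)[p.1]'hv.1)) hv.2.symm)
      · intro y _ hy
        rw [if_neg]
        intro hc
        apply hy
        have : ((qList q).insertIdx p.1 y)[p.1]? = some y := by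
          rw [List.getElem?_insertIdx_self, if_pos h1]
        rw [← hc, List.getElem?_eq_getElem hv.1] at this
        exact (Option.some.inj this).symm
      · simp
    · rw [if_neg hv, eq_comm]
      refine Finset.sum_eq_zero fun y _ => ?_
      rw [if_neg]
      intro hc
      apply hv
      rw [hc, List.length_insertIdx_of_le_length h1, List.eraseIdx_insertIdx_self]
      exact ⟨by omega, rfl⟩
  · refine Finset.sum_eq_zero fun v _ => ?_
    rw [if_neg]
    rintro ⟨h2, h3⟩
    rw [h3, List.length_eraseIdx, if_pos h2] at h1
    omega

theorem set_iff {l v : List X} {p : ℕ} {y : X} (hp : p < l.length) :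
    v = l.set p y ↔ v[p]? = some y ∧ l.eraseIdx p = v.eraseIdx p := by
  constructor
  · rintro rfl
    refine ⟨by rw [List.getElem?_set_self hp], ?_⟩
    rw [List.eraseIdx_set_eq]
  · rintro ⟨h1, h2⟩
    obtain ⟨h3, h4⟩ := List.getElem?_eq_some_iff.1 h1
    have e1 := List.insertIdx_eraseIdx_getElem h3
    have e2 : (l.set p y).eraseIdx p = v.eraseIdx p := by rw [List.eraseIdx_set_eq, h2]
    have e3 := List.insertIdx_eraseIdx_getElem (l := l.set p y) (n := p) (by simpa using hp)
    rw [← e1, h4, ← e2]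
    conv_rhs => rw [← e3]
    rw [List.getElem_set_self]

theorem T_mulVec (τ : AtpType 2) (p : Fin k) (f : QIdx X k → ℚ) (q) : (Tmat G k τ p).mulVec f q =
    if p.1 < (qList q).length then ∑ y,
      (if ∃ x, (qList q)[p.1]? = some x ∧ atp G 2 ![x, y] = τ then 1 else 0) * ext f ((qList q).set p.1 y) else 0 := by
  unfold Tmat Matrix.mulVec dotProduct
  simp only [Matrix.of_apply, ite_mul, one_mul, zero_mul]
  split_ifs with h1
  · have : ∀ (P : Prop) [Decidable P] (l : List X), (if P then ext f l else 0) = ∑ v, if P ∧ qList v = l then f v else 0 := by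
      intro P _ l
      unfold ext
      split_ifs with hP
      · simp [hP]
      · simp [hP]
    simp only [this]
    rw [Finset.sum_comm]
    refine Finset.sum_congr rfl fun v _ => ?_
    simp only [set_iff h1]
    by_cases hv : ∃ x y : X, (qList q)[p.val]? = some x ∧ (qList v)[p.val]? = some y ∧
        (qList q).eraseIdx p.val = (qList v).eraseIdx p.val ∧
        atp G 2 ![x, y] = τ
    · rw [if_pos hv]
      obtain ⟨x, y, hx, hy, he, ha⟩ := hv
      rw [Finset.sum_eq_single y]
      · rw [if_pos ⟨⟨x, hx, ha⟩, hy, he⟩]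
      · rintro y' _ hy'
        rw [if_neg]
        rintro ⟨_, h2, _⟩
        rw [hy] at h2
        exact hy' (Option.some.inj h2).symm
      · simp
    · rw [if_neg hv, eq_comm]
      refine Finset.sum_eq_zero fun y _ => ?_
      rw [if_neg]
      rintro ⟨⟨x, hx, ha⟩, h2, h3⟩
      exact hv ⟨x, y, hx, h2, h3, ha⟩
  · refine Finset.sum_eq_zero fun v _ => ?_
    rw [if_neg]
    rintro ⟨x, y, hx, _⟩
    rw [List.getElem?_eq_none (by omega)] at hx
    simp at hx
end

section
variable {ι : Type} [Fintype ι] {V : ι → Type} [∀ i, Fintype (V i)] (G : ∀ i, SimpleGraph (V i)) (k h : ℕ)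

theorem nodup_chi (i j : ι) (l : List (V i)) (l' : List (V j)) (h1 : 1 ≤ l.length) (h2 : l.length ≤ k+1)
    (h1' : 1 ≤ l'.length) (h2' : l'.length ≤ k+1) (hc : chiKH (G i) k h l = chiKH (G j) k h l') :
    l.Nodup ↔ l'.Nodup := by
  have e1 := List.ofFn_get l
  have e2 := List.ofFn_get l'
  rw [← e1, ← e2] at hc
  obtain ⟨hn, ha⟩ := chi_atp _ _ k h _ _ h1 h2 h1' h2' _ _ hc
  rw [List.nodup_iff_injective_get, List.nodup_iff_injective_get]
  have hfst : ∀ a b, l.get a = l.get b ↔ l'.get (Fin.cast hn a) = l'.get (Fin.cast hn b) := by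
    intro a b
    have := congrArg Prod.fst (congrFun (congrFun ha a) b)
    exact iff_of_eq this
  constructor
  · intro hI a b hab
    have := @hI (Fin.cast hn.symm a) (Fin.cast hn.symm b) ((hfst _ _).2 (by simpa using hab))
    simpa using this
  · intro hI a b hab
    have := hI ((hfst _ _).1 hab)
    simpa using this

/-- state vectors representable at all lengths -/
def RA (f : ∀ i, QIdx (V i) k → ℚ) : Prop := ∀ ℓ, 1 ≤ ℓ → ℓ ≤ k → Rep G k h ℓ (fun i l => ext (f i) l)

variable {G k h}

theorem RA.of (f : ∀ i, QIdx (V i) k → ℚ) (Ψ : ∀ i, List (V i) → ℚ)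
    (H : ∀ i q, f i q = Ψ i (qList q)) (hΨ : ∀ ℓ, 1 ≤ ℓ → ℓ ≤ k → Rep G k h ℓ Ψ) : RA G k h f := by
  intro ℓ h1 h2
  refine (Rep.mul h1 h2 (fun i l => if l.Nodup then 1 else 0) ?_ (hΨ ℓ h1 h2)).congr h2 ?_
  · intro i j l l' hl hl' hc
    refine if_congr ?_ rfl rfl
    exact nodup_chi G k h i j l l' (by omega) (by omega) (by omega) (by omega) hc
  · intro i l hl
    exact ext_of (f i) (Ψ i) (H i) l (by omega) (by omega)

theorem RA.P (a : ColorType k) {f : ∀ i, QIdx (V i) k → ℚ} (hf : RA G k h f) :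
    RA G k h (fun i => (Pmat (G i) k h a).mulVec (f i)) := by
  refine RA.of _ (fun i l => (if chiKH (G i) k h l = some a then 1 else 0) * ext (f i) l) ?_ ?_
  · intro i q; rw [P_mulVec, ext_qList]
  · intro ℓ h1 h2
    exact Rep.mul h1 h2 _ (fun i j l l' _ _ hl => chi_mult _ i j l l' hl) (hf ℓ h1 h2)

theorem RA.DM (p : Fin k) {f : ∀ i, QIdx (V i) k → ℚ} (hf : RA G k h f) :
    RA G k h (fun i => (DmatM (V i) k p).mulVec (f i)) := by
  refine RA.of _ (fun i l => if p.1 < l.length then ext (f i) (l.eraseIdx p.1) else 0) ?_ ?_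
  · intro i q; rw [DM_mulVec]
  · intro ℓ h1 h2
    by_cases hp : p.1 < ℓ
    · obtain ⟨ℓ, rfl⟩ : ∃ m, ℓ = m + 1 := ⟨ℓ - 1, by omega⟩
      rcases Nat.eq_zero_or_pos ℓ with rfl | h3
      · refine Rep.zero.congr h2 fun i l hl => ?_
        rw [if_pos (by omega), ext_zero]
        intro q hq
        have := congrArg List.length hq
        rw [qList_len, List.length_eraseIdx, if_pos (by omega)] at this
        omega
      · refine (Rep.erase h2 p.1 (by omega) (hf ℓ h3 (by omega))).congr h2 fun i l hl => ?_
        rw [if_pos (by omega)]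
    · refine Rep.zero.congr h2 fun i l hl => ?_
      rw [if_neg (by omega)]

theorem RA.DP (p : Fin k) {f : ∀ i, QIdx (V i) k → ℚ} (hf : RA G k h f) :
    RA G k h (fun i => (DmatP (V i) k p).mulVec (f i)) := by
  refine RA.of _ (fun i l => if p.1 ≤ l.length then ∑ y, ext (f i) (l.insertIdx p.1 y) else 0) ?_ ?_
  · intro i q; rw [DP_mulVec]
  · intro ℓ h1 h2
    by_cases hp : p.1 ≤ ℓ
    · rcases Nat.lt_or_ge ℓ k with h3 | h3
      · refine (Rep.ins h3 p.1 hp (hf (ℓ+1) (by omega) (by omega))).congr h2 fun i l hl => ?_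
        rw [if_pos (by omega)]
      · refine Rep.zero.congr h2 fun i l hl => ?_
        rw [if_pos (by omega)]
        refine Finset.sum_eq_zero fun y _ => ?_
        rw [ext_zero]
        intro q hq
        have := congrArg List.length hq
        rw [qList_len, List.length_insertIdx_of_le_length (by omega)] at this
        have := q.1.2
        omega
    · refine Rep.zero.congr h2 fun i l hl => ?_
      rw [if_neg (by omega)]

theorem RA.T (τ : AtpType 2) (p : Fin k) {f : ∀ i, QIdx (V i) k → ℚ} (hf : RA G k h f) :
    RA G k h (fun i => (Tmat (G i) k τ p).mulVec (f i)) := by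
  refine RA.of _ (fun i l => if p.1 < l.length then ∑ y,
      (if ∃ x, l[p.1]? = some x ∧ atp (G i) 2 ![x, y] = τ then 1 else 0) * ext (f i) (l.set p.1 y) else 0) ?_ ?_
  · intro i q; rw [T_mulVec]
  · intro ℓ h1 h2
    by_cases hp : p.1 < ℓ
    · refine (Rep.set h2 p.1 hp τ (hf ℓ h1 h2)).congr h2 fun i l hl => ?_
      rw [if_pos (by omega)]
    · refine Rep.zero.congr h2 fun i l hl => ?_
      rw [if_neg (by omega)]

theorem RA.sum {A : Type} (s : Finset A) (f : A → ∀ i, QIdx (V i) k → ℚ)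
    (hf : ∀ a ∈ s, RA G k h (f a)) : RA G k h (fun i => ∑ a ∈ s, f a i) := by
  refine RA.of _ (fun i l => ∑ a ∈ s, ext (f a i) l) ?_ ?_
  · intro i q; simp [ext_qList]
  · intro ℓ h1 h2
    exact Rep.sum s _ fun a ha => hf a ha ℓ h1 h2

theorem RA.letter {C : Type} (cval : C → ColorType k) (x : Letter C k) {f : ∀ i, QIdx (V i) k → ℚ}
    (hf : RA G k h f) : RA G k h (fun i => (swaTrans (G i) k h cval x).mulVec (f i)) := by
  rcases x with ⟨a, s, b⟩ | ⟨a, τ, p, b⟩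
  · simp only [swaTrans, Matrix.sum_mulVec, ← Matrix.mulVec_mulVec]
    refine RA.sum Finset.univ (fun p i => (Pmat (G i) k h (cval a)).mulVec ((if s = true then DmatP (V i) k p else DmatM (V i) k p).mulVec ((Pmat (G i) k h (cval b)).mulVec (f i)))) fun p _ => ?_
    cases s
    · simpa using RA.P (cval a) (RA.DM p (RA.P (cval b) hf))
    · simpa using RA.P (cval a) (RA.DP p (RA.P (cval b) hf))
  · simp only [swaTrans, ← Matrix.mulVec_mulVec]
    exact RA.P (cval a) (RA.T τ p (RA.P (cval b) hf))

/-- the backward vector of a word -/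
noncomputable def vec (G : ∀ i, SimpleGraph (V i)) (k h : ℕ) {C : Type} (cval : C → ColorType k)
    (w : List (Letter C k)) (i : ι) : QIdx (V i) k → ℚ :=
  w.foldr (fun c v => (swaTrans (G i) k h cval c).mulVec v) (fun _ => (1 : ℚ))

theorem series_eq {C : Type} (cval : C → ColorType k) (w : List (Letter C k)) (i : ι) :
    swaSeries (G i) k h cval w = ∑ q, vec G k h cval w i q := by
  unfold swaSeries vec dotProduct
  simp

theorem RA.vec {C : Type} (cval : C → ColorType k) (w : List (Letter C k)) :
    RA G k h (vec G k h cval w) := by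
  induction w with
  | nil => exact RA.of _ (fun _ _ => 1) (fun _ _ => rfl) (fun _ _ _ => Rep.one)
  | cons x w ih => exact RA.letter cval x ih

theorem Hub.swa (hk : 1 ≤ k) (H : Hub G k h) {C : Type} (cval : C → ColorType k)
    (w : List (Letter C k)) (i j : ι) :
    swaSeries (G i) k h cval w = swaSeries (G j) k h cval w := by
  rw [series_eq, series_eq, sum_ext, sum_ext]
  refine Finset.sum_congr rfl fun n hn => ?_
  have := Finset.mem_range.1 hn
  exact Rep.total hk H (by omega) (by omega) (RA.vec cval w (n+1) (by omega) (by omega)) i j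
end
end SWP

namespace SWP
set_option linter.unusedSectionVars false
set_option linter.unusedSimpArgs false
set_option linter.unnecessarySimpa false
open scoped Classical

section
variable {ι : Type} [Fintype ι] {V : ι → Type} [∀ i, Fintype (V i)] (G : ∀ i, SimpleGraph (V i)) (k h : ℕ)

/-- lift of a function on tuples to a function on lists -/
noncomputable def lft {X : Type} [Fintype X] (ℓ : ℕ) (F : (Fin ℓ → X) → ℚ) (l : List X) : ℚ :=
  ∑ u : Fin ℓ → X, if List.ofFn u = l then F u else 0

theorem lft_ofFn {X : Type} [Fintype X] {ℓ : ℕ} (F : (Fin ℓ → X) → ℚ) (u : Fin ℓ → X) :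
    lft ℓ F (List.ofFn u) = F u := by
  unfold lft
  rw [Finset.sum_eq_single u]
  · simp
  · intro b _ hb
    rw [if_neg fun hc => hb (List.ofFn_injective hc)]
  · simp

theorem lft_ne {X : Type} [Fintype X] {ℓ : ℕ} (F : (Fin ℓ → X) → ℚ) (l : List X) (hl : l.length ≠ ℓ) :
    lft ℓ F l = 0 := by
  unfold lft
  refine Finset.sum_eq_zero fun u _ => ?_
  rw [if_neg]
  rintro rfl
  simp at hl

theorem exists_ofFn {X : Type} {ℓ : ℕ} (l : List X) (hl : l.length = ℓ) :
    ∃ u : Fin ℓ → X, l = List.ofFn u := by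
  subst hl
  exact ⟨l.get, (List.ofFn_get l).symm⟩

theorem lft_eq {X : Type} [Fintype X] {ℓ : ℕ} (F : (Fin ℓ → X) → ℚ) (g : List X → ℚ)
    (h1 : ∀ u, g (List.ofFn u) = F u) (h2 : ∀ l, l.length ≠ ℓ → g l = 0) : lft ℓ F = g := by
  funext l
  by_cases hl : l.length = ℓ
  · obtain ⟨u, rfl⟩ := exists_ofFn l hl
    rw [lft_ofFn, h1]
  · rw [lft_ne F l hl, h2 l hl]

theorem lft_add {X : Type} [Fintype X] {ℓ : ℕ} (F F' : (Fin ℓ → X) → ℚ) :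
    lft ℓ (fun u => F u + F' u) = lft ℓ F + lft ℓ F' := by
  apply lft_eq
  · intro u; simp [lft_ofFn]
  · intro l hl; simp [lft_ne _ l hl]

theorem lft_smul {X : Type} [Fintype X] {ℓ : ℕ} (c : ℚ) (F : (Fin ℓ → X) → ℚ) :
    lft ℓ (fun u => c * F u) = c • lft ℓ F := by
  apply lft_eq
  · intro u; simp [lft_ofFn]
  · intro l hl; simp [lft_ne _ l hl]

theorem lft_mul {X : Type} [Fintype X] {ℓ : ℕ} (F F' : (Fin ℓ → X) → ℚ) :
    lft ℓ (fun u => F u * F' u) = lft ℓ F * lft ℓ F' := by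
  apply lft_eq
  · intro u; simp [lft_ofFn]
  · intro l hl; simp [lft_ne _ l hl]

theorem len_chi (i j : ι) (l : List (V i)) (l' : List (V j)) (h1 : 1 ≤ l.length) (h2 : l.length ≤ k+1)
    (h1' : 1 ≤ l'.length) (h2' : l'.length ≤ k+1) (hc : chiKH (G i) k h l = chiKH (G j) k h l') :
    l.length = l'.length := by
  have e1 := List.ofFn_get l
  have e2 := List.ofFn_get l'
  rw [← e1, ← e2] at hc
  exact (chi_atp _ _ k h _ _ h1 h2 h1' h2' _ _ hc).1

theorem lft_chi (ℓ : ℕ) (F : ∀ i, (Fin ℓ → V i) → ℚ)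
    (H : ∀ i j u v, chiKH (G i) k h (List.ofFn u) = chiKH (G j) k h (List.ofFn v) → F i u = F j v)
    (i j : ι) (l : List (V i)) (l' : List (V j)) (h1 : 1 ≤ l.length) (h2 : l.length ≤ k+1)
    (h1' : 1 ≤ l'.length) (h2' : l'.length ≤ k+1) (hc : chiKH (G i) k h l = chiKH (G j) k h l') :
    lft ℓ (F i) l = lft ℓ (F j) l' := by
  have hlen := len_chi G k h i j l l' h1 h2 h1' h2' hc
  by_cases hl : l.length = ℓ
  · obtain ⟨u, rfl⟩ := exists_ofFn l hl
    obtain ⟨v, rfl⟩ := exists_ofFn l' (hlen ▸ hl)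
    rw [lft_ofFn, lft_ofFn]
    exact H i j u v hc
  · rw [lft_ne _ _ hl, lft_ne _ _ (hlen ▸ hl)]

variable {C : Type} (cval : C → ColorType k)

/-- span of the backward vectors -/
noncomputable def AA : Submodule ℚ (∀ i, QIdx (V i) k → ℚ) :=
  Submodule.span ℚ (Set.range fun w : List (Letter C k) => vec G k h cval w)

variable {G k h cval}

theorem AA.total (hA : ∀ (w : List (Letter C k)) i j, swaSeries (G i) k h cval w = swaSeries (G j) k h cval w)
    {F : ∀ i, QIdx (V i) k → ℚ} (hF : F ∈ AA G k h cval) (i j : ι) : ∑ q, F i q = ∑ q, F j q := by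
  unfold AA at hF
  induction hF using Submodule.span_induction with
  | mem x hx => obtain ⟨w, rfl⟩ := hx; simpa only [series_eq] using hA w i j
  | zero => simp
  | add x y _ _ h1 h2 => simp [Finset.sum_add_distrib, h1, h2]
  | smul c x _ h1 => simp [← Finset.mul_sum, h1]

theorem AA.letter (x : Letter C k) {F : ∀ i, QIdx (V i) k → ℚ} (hF : F ∈ AA G k h cval) :
    (fun i => (swaTrans (G i) k h cval x).mulVec (F i)) ∈ AA G k h cval := by
  unfold AA at hF ⊢
  induction hF using Submodule.span_induction with
  | mem y hy => obtain ⟨w, rfl⟩ := hy; exact Submodule.subset_span ⟨x :: w, rfl⟩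
  | zero =>
    have : (fun i => (swaTrans (G i) k h cval x).mulVec ((0 : ∀ i, QIdx (V i) k → ℚ) i)) = 0 := by
      funext i; simp
    rw [this]; exact Submodule.zero_mem _
  | add y z _ _ h1 h2 =>
    have : (fun i => (swaTrans (G i) k h cval x).mulVec ((y + z) i)) =
      (fun i => (swaTrans (G i) k h cval x).mulVec (y i)) + (fun i => (swaTrans (G i) k h cval x).mulVec (z i)) := by
      funext i; simp [Matrix.mulVec_add]
    rw [this]; exact Submodule.add_mem _ h1 h2
  | smul c y _ h1 =>
    have : (fun i => (swaTrans (G i) k h cval x).mulVec ((c • y) i)) =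
      c • (fun i => (swaTrans (G i) k h cval x).mulVec (y i)) := by
      funext i; simp [Matrix.mulVec_smul]
    rw [this]; exact Submodule.smul_mem _ _ h1

/-- a color projection of a family of vectors -/
noncomputable def PP (G : ∀ i, SimpleGraph (V i)) (k h : ℕ) (x : ColorType k) (F : ∀ i, QIdx (V i) k → ℚ) :
    ∀ i, QIdx (V i) k → ℚ := fun i => (Pmat (G i) k h x).mulVec (F i)

theorem PP_apply (x : ColorType k) (F : ∀ i, QIdx (V i) k → ℚ) (i q) : PP G k h x F i q =
    (if chiKH (G i) k h (qList q) = some x then 1 else 0) * F i q := P_mulVec _ _ _ _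

theorem PP_none (hcov : ∀ i (l : List (V i)) x, chiKH (G i) k h l = some x → ∃ a, cval a = x)
    (x : ColorType k) (hx : ¬ ∃ a, cval a = x) (F : ∀ i, QIdx (V i) k → ℚ) : PP G k h x F = 0 := by
  funext i q
  rw [PP_apply, if_neg]
  · simp
  · exact fun hc => hx (hcov i _ x hc)

theorem chi_some {X : Type} [Fintype X] (G : SimpleGraph X) (q : QIdx X k) : ∃ x, chiKH G k h (qList q) = some x := by
  have := qList_len q
  rcases hq : qList q with _ | ⟨a, l⟩
  · rw [hq] at this; simp at this
  · simp only [chiKH]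
    split_ifs
    · exact ⟨_, rfl⟩
    · exact ⟨_, rfl⟩

theorem PP_resolve (F : ∀ i, QIdx (V i) k → ℚ) : ∃ CS : Finset (ColorType k), F = ∑ x ∈ CS, PP G k h x F := by
  choose col hcol using fun (p : Σ i, QIdx (V i) k) => chi_some (h := h) (G p.1) p.2
  refine ⟨Finset.univ.image col, ?_⟩
  funext i q
  rw [Finset.sum_apply, Finset.sum_apply, Finset.sum_eq_single (col ⟨i, q⟩)]
  · rw [PP_apply, if_pos (hcol ⟨i, q⟩), one_mul]
  · intro b _ hb
    rw [PP_apply, if_neg, zero_mul]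
    intro hc
    exact hb (Option.some.inj (hc.symm.trans (hcol ⟨i, q⟩)))
  · intro hc; exact absurd (Finset.mem_image_of_mem _ (Finset.mem_univ _)) hc

theorem AA.of_PP {F : ∀ i, QIdx (V i) k → ℚ} (H : ∀ x, PP G k h x F ∈ AA G k h cval) : F ∈ AA G k h cval := by
  obtain ⟨CS, hCS⟩ := PP_resolve (G := G) (h := h) F
  rw [hCS]
  exact Submodule.sum_mem _ fun x _ => H x

/-- atomic type of a repeated vertex -/
def tauEq : AtpType 2 := fun _ _ => (True, False)

theorem atp_tauEq {X : Type} (G : SimpleGraph X) (x y : X) : atp G 2 ![x, y] = tauEq ↔ y = x := by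
  constructor
  · intro hc
    have := congrArg Prod.fst (congrFun (congrFun hc 0) 1)
    simpa [atp, tauEq, eq_comm] using this
  · rintro rfl
    funext i j
    fin_cases i <;> fin_cases j <;> simp [atp, tauEq]

theorem T_eq {X : Type} [Fintype X] (G : SimpleGraph X) (p : Fin k) (hp : p.1 = 0) (f : QIdx X k → ℚ) :
    (Tmat G k tauEq p).mulVec f = f := by
  funext q
  rw [T_mulVec, if_pos (by rw [qList_len]; omega)]
  have hp0 : p.1 < (qList q).length := by rw [qList_len]; omega
  rw [Finset.sum_eq_single ((qList q)[p.1]'hp0)]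
  · rw [if_pos ⟨_, List.getElem?_eq_getElem hp0, (atp_tauEq _ _ _).2 rfl⟩, List.set_getElem_self, ext_qList, one_mul]
  · rintro y _ hy
    rw [if_neg, zero_mul]
    rintro ⟨x, hx, hxy⟩
    rw [List.getElem?_eq_getElem hp0] at hx
    rw [atp_tauEq] at hxy
    exact hy (hxy.trans (Option.some.inj hx).symm)
  · simp

theorem PP_idem (x : ColorType k) (F : ∀ i, QIdx (V i) k → ℚ) : PP G k h x (PP G k h x F) = PP G k h x F := by
  funext i q
  rw [PP_apply, PP_apply]
  split_ifs <;> simp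

section
variable (hk : 1 ≤ k) (hcov : ∀ i (l : List (V i)) x, chiKH (G i) k h l = some x → ∃ a, cval a = x)
include hk hcov

theorem AA.PPm (x : ColorType k) {F : ∀ i, QIdx (V i) k → ℚ} (hF : F ∈ AA G k h cval) :
    PP G k h x F ∈ AA G k h cval := by
  by_cases hx : ∃ a, cval a = x
  · obtain ⟨a, rfl⟩ := hx
    have := AA.letter (Sum.inr (a, tauEq, ⟨0, hk⟩, a)) hF
    simp only [swaTrans, ← Matrix.mulVec_mulVec] at this
    simp only [T_eq _ (⟨0, hk⟩ : Fin k) rfl] at this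
    rw [← PP_idem]
    exact this
  · rw [PP_none hcov x hx]; exact Submodule.zero_mem _

theorem AA.T (τ : AtpType 2) (p : Fin k) {F : ∀ i, QIdx (V i) k → ℚ} (hF : F ∈ AA G k h cval) :
    (fun i => (Tmat (G i) k τ p).mulVec (F i)) ∈ AA G k h cval := by
  refine AA.of_PP fun x => ?_
  obtain ⟨CS, hCS⟩ := PP_resolve (G := G) (h := h) F
  have : PP G k h x (fun i => (Tmat (G i) k τ p).mulVec (F i)) =
      ∑ y ∈ CS, PP G k h x (fun i => (Tmat (G i) k τ p).mulVec (PP G k h y F i)) := by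
    funext i
    conv_lhs => rw [hCS]
    rw [Finset.sum_apply]
    simp only [PP, Finset.sum_apply]
    rw [Matrix.mulVec_sum, Matrix.mulVec_sum]
  rw [this]
  refine Submodule.sum_mem _ fun y _ => ?_
  by_cases hx : ∃ a, cval a = x
  · by_cases hy : ∃ a, cval a = y
    · obtain ⟨a, rfl⟩ := hx
      obtain ⟨b, rfl⟩ := hy
      have := AA.letter (Sum.inr (a, τ, p, b)) hF
      simp only [swaTrans, ← Matrix.mulVec_mulVec] at this
      exact this
    · rw [PP_none hcov y hy]
      have : PP G k h x (fun i => (Tmat (G i) k τ p).mulVec ((0 : ∀ i, QIdx (V i) k → ℚ) i)) = 0 := by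
        funext i; simp [PP]
      rw [this]; exact Submodule.zero_mem _
  · rw [PP_none hcov x hx]; exact Submodule.zero_mem _

theorem AA.mulc (θ : ∀ i, QIdx (V i) k → ℚ)
    (H : ∀ i j q q', chiKH (G i) k h (qList q) = chiKH (G j) k h (qList q') → θ i q = θ j q')
    {F : ∀ i, QIdx (V i) k → ℚ} (hF : F ∈ AA G k h cval) : (fun i q => θ i q * F i q) ∈ AA G k h cval := by
  obtain ⟨g, hg⟩ := exists_factor (fun i q => chiKH (G i) k h (qList q)) θ H
  refine AA.of_PP fun x => ?_
  have : PP G k h x (fun i q => θ i q * F i q) = g (some x) • PP G k h x F := by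
    funext i q
    rw [Pi.smul_apply, Pi.smul_apply, PP_apply, PP_apply, hg]
    split_ifs with hx
    · simp [hx]
    · simp
  rw [this]
  exact Submodule.smul_mem _ _ (AA.PPm hk hcov x hF)

theorem AA.one : (fun _ _ => 1) ∈ AA G k h cval := Submodule.subset_span ⟨[], rfl⟩

theorem AA.T' (κ : AtpType 2 → ℚ) (p : Fin k) {F : ∀ i, (Fin k → V i) → ℚ} (hs : ∀ i u, inj u * F i u = F i u)
    (hF : (fun i q => lft k (F i) (qList q)) ∈ AA G k h cval) :
    (fun i q => lft k (fun u => inj u * ∑ y, κ (atp (G i) 2 ![u p, y]) * F i (Function.update u p y)) (qList q))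
      ∈ AA G k h cval := by
  have : (fun i q => lft k (fun u => inj u * ∑ y, κ (atp (G i) 2 ![u p, y]) * F i (Function.update u p y)) (qList q))
    = ∑ τ : AtpType 2, κ τ • (fun i => (Tmat (G i) k τ p).mulVec (fun q => lft k (F i) (qList q))) := by
    funext i q
    rw [Finset.sum_apply, Finset.sum_apply]
    simp only [Pi.smul_apply, T_mulVec, smul_eq_mul]
    have hext : ∀ w : Fin k → V i, ext (fun q : QIdx (V i) k => lft k (F i) (qList q)) (List.ofFn w) = F i w := by
      intro w
      rw [ext_of _ (lft k (F i)) (fun q => rfl) _ (by simpa using hk) (by simp), lft_ofFn]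
      simp only [List.nodup_ofFn]
      exact hs i w
    by_cases hl : (qList q).length = k
    · have hnd := qList_nodup q
      have hp : p.1 < (qList q).length := by rw [hl]; exact p.2
      simp only [if_pos hp]
      obtain ⟨u, hu⟩ := exists_ofFn _ hl
      rw [hu] at hnd ⊢
      rw [lft_ofFn]
      have : inj u = 1 := if_pos (List.nodup_ofFn.1 hnd)
      rw [this, one_mul]
      simp only [Finset.mul_sum]
      rw [Finset.sum_comm]
      refine Finset.sum_congr rfl fun y _ => ?_
      have hset : (List.ofFn u).set p.1 y = List.ofFn (Function.update u p y) := by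
        apply List.ext_getElem
        · simp
        · intro n h1 h2
          simp [List.getElem_set, Function.update_apply, Fin.ext_iff, eq_comm]
      rw [hset, hext, Finset.sum_eq_single (atp (G i) 2 ![u p, y])]
      · rw [if_pos ⟨u p, by simp, rfl⟩, one_mul]
      · intro b _ hb
        rw [if_neg]
        · simp
        · rintro ⟨x, hx, rfl⟩
          apply hb
          have : x = u p := by simpa [eq_comm] using hx
          rw [this]
      · simp
    · rw [lft_ne _ _ hl, eq_comm]
      refine Finset.sum_eq_zero fun τ _ => ?_
      split_ifs
      · rw [Finset.sum_eq_zero, mul_zero]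
        intro y _
        unfold ext
        rw [Finset.sum_eq_zero, mul_zero]
        intro q' _
        split_ifs with hq
        · refine lft_ne _ _ ?_
          rw [hq, List.length_set]; exact hl
        · rfl
      · simp
  rw [this]
  exact Submodule.sum_mem _ fun τ _ => Submodule.smul_mem _ _ (AA.T hk hcov τ p hF)

theorem AA.lchi (ℓ : ℕ) (θ : ∀ i, (Fin ℓ → V i) → ℚ)
    (H : ∀ i j u v, chiKH (G i) k h (List.ofFn u) = chiKH (G j) k h (List.ofFn v) → θ i u = θ j v)
    {F : ∀ i, (Fin ℓ → V i) → ℚ} (hF : (fun i q => lft ℓ (F i) (qList q)) ∈ AA G k h cval) :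
    (fun i q => lft ℓ (fun u => θ i u * F i u) (qList q)) ∈ AA G k h cval := by
  simp only [lft_mul]
  refine AA.mulc hk hcov (fun i q => lft ℓ (θ i) (qList q)) ?_ hF
  intro i j q q' hq
  have h1 := qList_len q
  have h2 := qList_len q'
  have h3 := q.1.2
  have h4 := q'.1.2
  exact lft_chi G k h ℓ θ H i j _ _ (by omega) (by omega) (by omega) (by omega) hq

theorem AA.lone (ℓ : ℕ) : (fun i q => lft ℓ (fun _ => 1) (qList q)) ∈ AA G k h cval := by
  have := AA.mulc hk hcov (fun i q => lft ℓ (fun _ => 1) (qList q)) ?_ (AA.one hk hcov)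
  · simpa using this
  intro i j q q' hq
  have h1 := qList_len q
  have h2 := qList_len q'
  have h3 := q.1.2
  have h4 := q'.1.2
  exact lft_chi G k h ℓ (fun _ _ => 1) (fun _ _ _ _ _ => rfl) i j _ _ (by omega) (by omega) (by omega) (by omega) hq

theorem AA.RI {F : ∀ i, (Fin k → V i) → ℚ} (hF : RI G k h F) :
    (fun i q => lft k (F i) (qList q)) ∈ AA G k h cval := by
  induction hF with
  | one =>
    convert AA.lone hk hcov k using 1
    funext i q
    by_cases hl : (qList q).length = k
    · have hnd := qList_nodup q
      obtain ⟨u, hu⟩ := exists_ofFn _ hl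
      rw [hu] at hnd ⊢
      rw [lft_ofFn, lft_ofFn]
      exact if_pos (List.nodup_ofFn.1 hnd)
    · rw [lft_ne _ _ hl, lft_ne _ _ hl]
  | add _ _ h1 h2 => simp only [lft_add]; exact Submodule.add_mem _ h1 h2
  | smul c _ h1 => simp only [lft_smul]; exact Submodule.smul_mem _ c h1
  | mul g _ h1 =>
    refine AA.lchi hk hcov k (fun i u => g (wl (G i) k h u)) ?_ h1
    intro i j u v hc
    rw [(chi_wl _ _ k h hk u v).1 hc]
  | all p hF h1 =>
    convert AA.T' hk hcov (fun _ => 1) p hF.supp h1 using 6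
    simp
  | adj p hF h1 =>
    convert AA.T' hk hcov (fun τ => if (τ 0 1).2 then 1 else 0) p hF.supp h1 using 6
    rfl

omit hcov in
theorem sum_lft {X : Type} [Fintype X] (ℓ : ℕ) (h1 : 1 ≤ ℓ) (h2 : ℓ ≤ k) (F : (Fin ℓ → X) → ℚ) (hs : ∀ u, inj u * F u = F u) :
    ∑ q : QIdx X k, lft ℓ F (qList q) = ∑ u, F u := by
  unfold lft
  rw [Finset.sum_comm]
  refine Finset.sum_congr rfl fun u _ => ?_
  by_cases hu : Function.Injective u
  · obtain ⟨q, hq⟩ := qList_surj (k := k) (List.ofFn u) (by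
      intro hc
      have := congrArg List.length hc
      simp at this; omega) (List.nodup_ofFn.2 hu) (by simpa using h2)
    rw [Finset.sum_eq_single q]
    · rw [if_pos hq.symm]
    · intro b _ hb
      rw [if_neg]
      intro hc
      exact hb (qList_inj (hc.symm.trans hq.symm))
    · simp
  · rw [← hs u, inj, if_neg hu]
    simp

theorem hub_of_swa (hA : ∀ (w : List (Letter C k)) i j, swaSeries (G i) k h cval w = swaSeries (G j) k h cval w) :
    Hub G k h where
  card := by
    intro i j
    have := AA.total hA (AA.lone (G := G) (h := h) hk hcov 1) i j
    rw [sum_lft hk 1 le_rfl hk, sum_lft hk 1 le_rfl hk] at this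
    · simpa using this
    · intro u; rw [inj, if_pos (Function.injective_of_subsingleton u), one_mul]
    · intro u; rw [inj, if_pos (Function.injective_of_subsingleton u), one_mul]
  atpm := by
    intro i j ℓ h1 h2 u hu
    have hmem := AA.mulc hk hcov (fun i' q => if chiKH (G i') k h (qList q) = chiKH (G i) k h (List.ofFn u) then 1 else 0)
      (by intro i j q q' hq; simp only [hq]) (AA.one (G := G) (h := h) hk hcov)
    have htot := AA.total hA hmem i j
    obtain ⟨q, hq⟩ := qList_surj (k := k) (List.ofFn u) (by
      intro hc
      have := congrArg List.length hc
      simp at this; omega) (List.nodup_ofFn.2 hu) (by simpa using h2)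
    have hpos : 0 < ∑ q : QIdx (V i) k, (if chiKH (G i) k h (qList q) = chiKH (G i) k h (List.ofFn u) then (1:ℚ) else 0) * 1 := by
      refine Finset.sum_pos' (fun q _ => by split_ifs <;> simp) ⟨q, Finset.mem_univ _, ?_⟩
      rw [hq]; simp
    rw [htot] at hpos
    obtain ⟨q', _, hq'⟩ := Finset.exists_ne_zero_of_sum_ne_zero hpos.ne'
    have hc : chiKH (G j) k h (qList q') = chiKH (G i) k h (List.ofFn u) := by
      by_contra hc; simp [hc] at hq'
    have h3 := q'.1.2
    obtain ⟨hn, ha⟩ := chi_atp (G i) (G j) k h ℓ _ h1 (by omega) (Nat.succ_pos _) (by omega) u (q'.2 : Fin (q'.1.1+1) → V j) hc.symm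
    exact ⟨_, ha⟩
  sum := by
    intro F hF i j
    have := AA.total hA (AA.RI (G := G) (h := h) hk hcov hF) i j
    rwa [sum_lft hk k hk le_rfl _ (hF.supp i), sum_lft hk k hk le_rfl _ (hF.supp j)] at this
end
end
end SWP

namespace SWP
set_option linter.unusedSectionVars false
set_option linter.unusedSimpArgs false
set_option linter.unnecessarySimpa false
open scoped Classical

section
variable {X : Type}

/-- insert an entry -/
def ins {n : ℕ} (p : Fin (n+1)) (y : X) (u : Fin n → X) : Fin (n+1) → X :=
  Fin.insertNth (α := fun _ => X) p y u

/-- delete the last entry -/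
def ini {n : ℕ} (u : Fin (n+1) → X) : Fin n → X := fun j => u j.castSucc

theorem ins_same {n : ℕ} (p : Fin (n+1)) (y : X) (u : Fin n → X) : ins p y u p = y :=
  Fin.insertNth_apply_same (α := fun _ => X) p y u

theorem ins_above {n : ℕ} (p : Fin (n+1)) (y : X) (u : Fin n → X) (j) : ins p y u (p.succAbove j) = u j :=
  Fin.insertNth_apply_succAbove (α := fun _ => X) p y u j

theorem ins_eq {n : ℕ} (p : Fin (n+1)) (y : X) (u : Fin n → X) (w : Fin (n+1) → X) (h1 : w p = y)
    (h2 : ∀ j, w (p.succAbove j) = u j) : ins p y u = w := by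
  funext a
  rcases Fin.eq_self_or_eq_succAbove p a with rfl | ⟨j, rfl⟩
  · rw [ins_same, h1]
  · rw [ins_above, h2]

theorem ins_ini {n : ℕ} (p : Fin (n+1)) (y : X) (u : Fin (n+1) → X) :
    ini (ins p.castSucc y u) = ins p y (ini u) := by
  symm
  apply ins_eq
  · exact ins_same _ _ _
  · intro j
    unfold ini
    rw [← Fin.castSucc_succAbove_castSucc, ins_above]

theorem ins_last' {n : ℕ} (p : Fin (n+1)) (y : X) (u : Fin (n+1) → X) :
    ins p.castSucc y u (Fin.last _) = u (Fin.last _) := by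
  rw [← Fin.succAbove_ne_last_last (a := p.castSucc) (Fin.castSucc_lt_last p).ne, ins_above]

theorem ins_last {n : ℕ} (y : X) (u : Fin n → X) : ins (Fin.last n) y u = Fin.snoc u y := by
  apply ins_eq
  · simp
  · intro j; rw [Fin.succAbove_last]; simp

theorem ini_ins_last {n : ℕ} (y : X) (u : Fin n → X) : ini (ins (Fin.last n) y u) = u := by
  rw [ins_last]; funext j; simp [ini]

theorem ins_last_ini {n : ℕ} (y : X) (u : Fin (n+1) → X) :
    ins (Fin.last n) y (ini u) = Function.update u (Fin.last n) y := by
  apply ins_eq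
  · simp
  · intro j; rw [Fin.succAbove_last, Function.update_of_ne (Fin.castSucc_lt_last j).ne]; rfl

theorem insertIdx_ofFn {n : ℕ} (p : Fin (n+1)) (y : X) (u : Fin n → X) :
    (List.ofFn u).insertIdx p.1 y = List.ofFn (ins p y u) := by
  have hp := p.2
  apply List.ext_getElem
  · rw [List.length_insertIdx_of_le_length (by simp; omega)]; simp
  · intro a h1 h2
    rw [List.getElem_ofFn]
    have ha : a < n+1 := by simpa using h2
    have key : ∀ b : Fin (n+1), b.1 = a → ((List.ofFn u).insertIdx p.1 y)[a] = ins p y u b := by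
      intro b hb
      rcases Fin.eq_self_or_eq_succAbove p b with rfl | ⟨j, rfl⟩
      · subst hb
        rw [ins_same, List.getElem_insertIdx_self]
      · rw [ins_above]
        subst hb
        by_cases hj : j.castSucc < p
        · have e : (p.succAbove j).1 = j.1 := by rw [Fin.succAbove_of_castSucc_lt p j hj]; rfl
          simp only [e]
          rw [List.getElem_insertIdx_of_lt (by simpa [Fin.lt_def] using hj)]
          simp
        · have e : (p.succAbove j).1 = j.1 + 1 := by rw [Fin.succAbove_of_le_castSucc p j (not_lt.1 hj)]; rfl
          simp only [e]
          have : p.1 < j.1 + 1 := by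
            have := not_lt.1 hj
            rw [Fin.le_def] at this
            simp at this; omega
          rw [List.getElem_insertIdx_of_gt this]
          simp
    exact key ⟨a, ha⟩ rfl

theorem dropLast_ofFn' {n : ℕ} (u : Fin (n+1) → X) : (List.ofFn u).dropLast = List.ofFn (ini u) :=
  dropLast_ofFn u
end

section
variable {ι : Type} [Fintype ι] {V : ι → Type} [∀ i, Fintype (V i)] (G : ∀ i, SimpleGraph (V i)) (k h : ℕ)

/-- span of the counting functions -/
noncomputable def S0 : Submodule ℚ (∀ i, List (V i) → ℚ) :=
  Submodule.span ℚ (Set.range fun tc : ℕ × List (Option (ColorType k)) => fsw G k h tc.1 tc.2)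

/-- functions agreeing on relevant lists with an element of the span -/
def SS (F : ∀ i, List (V i) → ℚ) : Prop :=
  ∃ F' ∈ S0 G k h, ∀ i l, 1 ≤ l.length → l.length ≤ k+1 → F i l = F' i l

variable {G k h}

theorem SS.congr {F F' : ∀ i, List (V i) → ℚ} (hF : SS G k h F)
    (H : ∀ i l, 1 ≤ l.length → l.length ≤ k+1 → F' i l = F i l) : SS G k h F' := by
  obtain ⟨A, hA, hA'⟩ := hF
  exact ⟨A, hA, fun i l h1 h2 => (H i l h1 h2).trans (hA' i l h1 h2)⟩

theorem SS.add {F F' : ∀ i, List (V i) → ℚ} (hF : SS G k h F) (hF' : SS G k h F') : SS G k h (F + F') := by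
  obtain ⟨A, hA, hA'⟩ := hF
  obtain ⟨B, hB, hB'⟩ := hF'
  exact ⟨A + B, Submodule.add_mem _ hA hB, fun i l h1 h2 => by simp [hA' i l h1 h2, hB' i l h1 h2]⟩

theorem SS.smul (c : ℚ) {F : ∀ i, List (V i) → ℚ} (hF : SS G k h F) : SS G k h (c • F) := by
  obtain ⟨A, hA, hA'⟩ := hF
  exact ⟨c • A, Submodule.smul_mem _ _ hA, fun i l h1 h2 => by simp [hA' i l h1 h2]⟩

theorem SS.zero : SS G k h (0 : ∀ i, List (V i) → ℚ) := ⟨0, Submodule.zero_mem _, fun _ _ _ _ => rfl⟩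

theorem SS.sum {A : Type*} (s : Finset A) (F : A → ∀ i, List (V i) → ℚ)
    (hF : ∀ a ∈ s, SS G k h (F a)) : SS G k h (∑ a ∈ s, F a) := by
  induction s using Finset.induction_on with
  | empty => simpa using SS.zero
  | insert a s ha ih =>
    rw [Finset.sum_insert ha]
    exact SS.add (hF a (by simp)) (ih fun b hb => hF b (by simp [hb]))

theorem SS.gen (t c) : SS G k h (fsw G k h t c) := ⟨_, Submodule.subset_span ⟨(t, c), rfl⟩, fun _ _ _ _ => rfl⟩

theorem SS.total (hS : ∀ t i j, SwT (G i) k h t = SwT (G j) k h t)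
    {F : ∀ i, List (V i) → ℚ} (hF : SS G k h F) (i j : ι) :
    ∑ n ∈ Finset.range k, ∑ u : Fin (n+1) → V i, F i (List.ofFn u) =
    ∑ n ∈ Finset.range k, ∑ u : Fin (n+1) → V j, F j (List.ofFn u) := by
  obtain ⟨A, hA, hA'⟩ := hF
  have e : ∀ i, ∑ n ∈ Finset.range k, ∑ u : Fin (n+1) → V i, F i (List.ofFn u) =
      ∑ n ∈ Finset.range k, ∑ u : Fin (n+1) → V i, A i (List.ofFn u) := by
    intro i
    refine Finset.sum_congr rfl fun n hn => Finset.sum_congr rfl fun u _ => ?_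
    have := Finset.mem_range.1 hn
    exact hA' i _ (by simp) (by simp; omega)
  rw [e, e]
  clear e hA' F
  unfold S0 at hA
  induction hA using Submodule.span_induction with
  | mem x hx => obtain ⟨⟨t, c⟩, rfl⟩ := hx; simp only [← count_SwT]; rw [hS t i j]
  | zero => simp
  | add x y _ _ h1 h2 => simp only [Pi.add_apply, Finset.sum_add_distrib, h1, h2]
  | smul c x _ h1 => simp only [Pi.smul_apply, smul_eq_mul, ← Finset.mul_sum, h1]

/-- closure principle for linear operators -/
theorem SS.lin (L : (∀ i, List (V i) → ℚ) → ∀ i, List (V i) → ℚ)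
    (hadd : ∀ A B, L (A + B) = L A + L B) (hsmul : ∀ (c : ℚ) A, L (c • A) = c • L A)
    (hloc : ∀ A B : ∀ i, List (V i) → ℚ, (∀ i l, 1 ≤ l.length → l.length ≤ k+1 → A i l = B i l) →
      ∀ i l, 1 ≤ l.length → l.length ≤ k+1 → L A i l = L B i l)
    (hgen : ∀ t c, SS G k h (L (fsw G k h t c)))
    {F : ∀ i, List (V i) → ℚ} (hF : SS G k h F) : SS G k h (L F) := by
  obtain ⟨A, hA, hA'⟩ := hF
  refine SS.congr (F := L A) ?_ (hloc _ _ hA')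
  clear hA'
  unfold S0 at hA
  induction hA using Submodule.span_induction with
  | mem x hx => obtain ⟨⟨t, c⟩, rfl⟩ := hx; exact hgen t c
  | zero => have := hsmul 0 0; simp at this; rw [this]; exact SS.zero
  | add x y _ _ h1 h2 => rw [hadd]; exact h1.add h2
  | smul c x _ h1 => rw [hsmul]; exact h1.smul c

theorem fsw_chi (t c x) (i : ι) (l : List (V i)) (hne : fsw G k h t (c ++ [x]) i l ≠ 0) : chiKH (G i) k h l = x := by
  by_contra hx
  apply hne
  cases t with
  | zero =>
    rw [fsw_zero, if_neg]
    rintro ⟨_, h2⟩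
    have := List.append_inj' (s₂ := []) h2 rfl
    exact hx (by simpa using this.2.symm)
  | succ t => rw [fsw_succ, if_neg hx, zero_mul]

theorem fsw_nil (t) (i : ι) (l : List (V i)) : fsw G k h t [] i l = 0 := by
  cases t with
  | zero => rw [fsw_zero, if_neg]; simp
  | succ t => rw [fsw_succ_nil]

theorem SS.mulc (θ : ∀ i, List (V i) → ℚ)
    (H : ∀ i j l l', 1 ≤ l.length → l.length ≤ k+1 → 1 ≤ l'.length → l'.length ≤ k+1 →
      chiKH (G i) k h l = chiKH (G j) k h l' → θ i l = θ j l')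
    {F : ∀ i, List (V i) → ℚ} (hF : SS G k h F) : SS G k h (fun i l => θ i l * F i l) := by
  refine SS.lin (fun F i l => θ i l * F i l) ?_ ?_ ?_ ?_ hF
  · intro A B; funext i l; simp [mul_add]
  · intro c A; funext i l; simp [mul_left_comm]
  · intro A B hAB i l h1 h2; simp only [hAB i l h1 h2]
  · intro t c
    obtain ⟨g, hg⟩ := exists_factor (ι := ι) (A := fun i => {l : List (V i) // 1 ≤ l.length ∧ l.length ≤ k+1})
      (fun i l => chiKH (G i) k h l.1) (fun i l => θ i l.1)
      (fun i j u v huv => H i j u.1 v.1 u.2.1 u.2.2 v.2.1 v.2.2 huv)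
    rcases List.eq_nil_or_concat c with rfl | ⟨c, x, rfl⟩
    · simp only [fsw_nil, mul_zero]; exact SS.zero
    · refine ((SS.gen t (c ++ [x])).smul (g x)).congr fun i l h1 h2 => ?_
      simp only [Pi.smul_apply, smul_eq_mul, List.concat_eq_append]
      by_cases hne : fsw G k h t (c ++ [x]) i l = 0
      · rw [hne]; simp
      · rw [hg i ⟨l, h1, h2⟩, fsw_chi t c x i l hne]

theorem exists_colors (G : ∀ i, SimpleGraph (V i)) (k h : ℕ) : ∃ CS : Finset (Option (ColorType k)), ∀ i (l : List (V i)), l.length ≤ k+1 →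
    chiKH (G i) k h l ∈ CS := by
  refine ⟨Finset.univ.image (fun p : Σ i, Σ n : Fin (k+2), Fin n → V i => chiKH (G p.1) k h (List.ofFn p.2.2)), ?_⟩
  intro i l hl
  obtain ⟨u, hu⟩ := exists_ofFn l rfl
  refine Finset.mem_image.2 ⟨⟨i, ⟨l.length, by omega⟩, u⟩, Finset.mem_univ _, ?_⟩
  exact congrArg (chiKH (G i) k h) hu.symm

/-- the refinement step -/
noncomputable def stepOp (k : ℕ) (F : ∀ i, List (V i) → ℚ) : ∀ i, List (V i) → ℚ := fun i l =>
  (if 1 < l.length then F i l.dropLast else 0) +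
       (if l.length ≤ k then ∑ p ∈ Finset.range (l.length + 1), ∑ y, F i (l.insertIdx p y) else 0)

theorem SS.step {F : ∀ i, List (V i) → ℚ} (hF : SS G k h F) : SS G k h (stepOp k F) := by
  refine SS.lin (stepOp k) ?_ ?_ ?_ ?_ hF
  · intro A B; funext i l
    simp only [stepOp, Pi.add_apply]
    split_ifs <;> simp [Finset.sum_add_distrib] <;> ring
  · intro c A; funext i l
    simp only [stepOp, Pi.smul_apply, smul_eq_mul]
    split_ifs <;> simp [Finset.mul_sum, mul_add]
  · intro A B hAB i l h1 h2
    simp only [stepOp]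
    congr 1
    · split_ifs with h3
      · exact hAB _ _ (by simp; omega) (by simp; omega)
      · rfl
    · split_ifs with h3
      · refine Finset.sum_congr rfl fun p hp => Finset.sum_congr rfl fun y _ => ?_
        have := Finset.mem_range.1 hp
        exact hAB _ _ (by rw [List.length_insertIdx_of_le_length (by omega)]; omega)
          (by rw [List.length_insertIdx_of_le_length (by omega)]; omega)
      · rfl
  · intro t c
    obtain ⟨CS, hCS⟩ := exists_colors G k h
    refine (SS.sum CS (fun x => fsw G k h (t+1) (c ++ [x])) fun x _ => SS.gen _ _).congr fun i l h1 h2 => ?_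
    rw [Finset.sum_apply, Finset.sum_apply, Finset.sum_eq_single (chiKH (G i) k h l)]
    · rw [fsw_succ, if_pos rfl, one_mul]; rfl
    · intro x _ hx
      rw [fsw_succ, if_neg hx.symm, zero_mul]
    · intro hc; exact absurd (hCS i l h2) hc

theorem SS.base : SS G k h (fun i l => if l.length = 1 then 1 else 0) := by
  obtain ⟨CS, hCS⟩ := exists_colors G k h
  refine (SS.sum CS (fun x => fsw G k h 0 [x]) fun x _ => SS.gen _ _).congr fun i l h1 h2 => ?_
  rw [Finset.sum_apply, Finset.sum_apply, Finset.sum_eq_single (chiKH (G i) k h l)]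
  · rw [fsw_zero]; simp
  · intro x _ hx
    rw [fsw_zero, if_neg]
    rintro ⟨_, h3⟩
    exact hx (by simpa using h3)
  · intro hc; exact absurd (hCS i l h2) hc

variable (G k h) in
/-- level-wise membership -/
def SL (ℓ : ℕ) (F : ∀ i, (Fin ℓ → V i) → ℚ) : Prop := SS G k h (fun i => lft ℓ (F i))

theorem SL.add {ℓ : ℕ} {F F' : ∀ i, (Fin ℓ → V i) → ℚ} (hF : SL G k h ℓ F) (hF' : SL G k h ℓ F') :
    SL G k h ℓ (fun i u => F i u + F' i u) := by
  unfold SL; simp only [lft_add]; exact SS.add hF hF'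

theorem SL.smul (c : ℚ) {ℓ : ℕ} {F : ∀ i, (Fin ℓ → V i) → ℚ} (hF : SL G k h ℓ F) :
    SL G k h ℓ (fun i u => c * F i u) := by
  unfold SL; simp only [lft_smul]; exact SS.smul c hF

theorem SL.sub {ℓ : ℕ} {F F' : ∀ i, (Fin ℓ → V i) → ℚ} (hF : SL G k h ℓ F) (hF' : SL G k h ℓ F') :
    SL G k h ℓ (fun i u => F i u - F' i u) := by
  have := hF.add (hF'.smul (-1))
  convert this using 4
  ring

theorem SL.congr {ℓ : ℕ} {F F' : ∀ i, (Fin ℓ → V i) → ℚ} (hF : SL G k h ℓ F) (H : ∀ i u, F' i u = F i u) :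
    SL G k h ℓ F' := by
  have : F' = F := by funext i u; exact H i u
  rwa [this]

theorem SL.mulc {ℓ : ℕ} (θ : ∀ i, (Fin ℓ → V i) → ℚ)
    (H : ∀ i j u v, chiKH (G i) k h (List.ofFn u) = chiKH (G j) k h (List.ofFn v) → θ i u = θ j v)
    {F : ∀ i, (Fin ℓ → V i) → ℚ} (hF : SL G k h ℓ F) : SL G k h ℓ (fun i u => θ i u * F i u) := by
  unfold SL
  simp only [lft_mul]
  exact SS.mulc (fun i => lft ℓ (θ i)) (fun i j l l' h1 h2 h3 h4 hc => lft_chi G k h ℓ θ H i j l l' h1 h2 h3 h4 hc) hF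

theorem SL.matp {ℓ : ℕ} (h1 : 1 ≤ ℓ) (h2 : ℓ ≤ k+1) (κ : AtpType ℓ → ℚ)
    {F : ∀ i, (Fin ℓ → V i) → ℚ} (hF : SL G k h ℓ F) : SL G k h ℓ (fun i u => κ (atp (G i) ℓ u) * F i u) := by
  refine SL.mulc (fun i u => κ (atp (G i) ℓ u)) ?_ hF
  intro i j u v hc
  obtain ⟨_, ha⟩ := chi_atp _ _ k h ℓ ℓ h1 h2 h1 h2 u v hc
  rw [ha]; rfl

theorem SL.matp' {ℓ : ℕ} (h1 : 1 ≤ ℓ) (h2 : ℓ ≤ k+1) (θ : ∀ i, (Fin ℓ → V i) → ℚ)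
    (H : ∀ i j u v, atp (G i) ℓ u = atp (G j) ℓ v → θ i u = θ j v)
    {F : ∀ i, (Fin ℓ → V i) → ℚ} (hF : SL G k h ℓ F) : SL G k h ℓ (fun i u => θ i u * F i u) := by
  obtain ⟨g, hg⟩ := exists_factor (fun i u => atp (G i) ℓ u) θ H
  simp only [hg]
  exact SL.matp h1 h2 g hF

theorem SL.proj {ℓ : ℕ} {F : ∀ i, List (V i) → ℚ} (hF : SS G k h F) :
    SL G k h ℓ (fun i u => F i (List.ofFn u)) := by
  have := SS.mulc (fun i => lft ℓ (fun _ => 1)) (fun i j l l' h1 h2 h3 h4 hc => lft_chi G k h ℓ (fun _ _ => 1) (fun _ _ _ _ _ => rfl) i j l l' h1 h2 h3 h4 hc) hF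
  refine SS.congr this fun i l h1 h2 => ?_
  by_cases hl : l.length = ℓ
  · obtain ⟨u, rfl⟩ := exists_ofFn l hl
    rw [lft_ofFn, lft_ofFn, one_mul]
  · rw [lft_ne _ _ hl, lft_ne _ _ hl, zero_mul]

theorem SL.app {ℓ : ℕ} (h1 : 1 ≤ ℓ) {F : ∀ i, (Fin ℓ → V i) → ℚ} (hF : SL G k h ℓ F) :
    SL G k h (ℓ+1) (fun i u => F i (ini u)) := by
  refine (SL.proj (SS.step hF)).congr fun i u => ?_
  unfold stepOp
  rw [if_pos (by simp; omega), dropLast_ofFn']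
  simp only [lft_ofFn]
  have : ∀ (P : Prop) [Decidable P] (x : ℚ), x = 0 → (if P then x else 0) = 0 := by
    intro P _ x hx; rw [hx]; simp
  rw [this, add_zero]
  refine Finset.sum_eq_zero fun p hp => Finset.sum_eq_zero fun y _ => ?_
  apply lft_ne
  have := Finset.mem_range.1 hp
  rw [List.length_insertIdx_of_le_length (by omega)]
  simp only [List.length_ofFn]
  omega

theorem SL.del {ℓ : ℕ} (h1 : 1 ≤ ℓ) (h2 : ℓ ≤ k) {F : ∀ i, (Fin (ℓ+1) → V i) → ℚ} (hF : SL G k h (ℓ+1) F) :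
    SL G k h ℓ (fun i u => ∑ p : Fin (ℓ+1), ∑ y, F i (ins p y u)) := by
  refine (SL.proj (SS.step hF)).congr fun i u => ?_
  unfold stepOp
  have : ∀ (P : Prop) [Decidable P] (x : ℚ), x = 0 → (if P then x else 0) = 0 := by
    intro P _ x hx; rw [hx]; simp
  rw [this, zero_add, if_pos (by simpa using h2)]
  · simp only [List.length_ofFn]
    rw [Finset.sum_range]
    refine Finset.sum_congr rfl fun p _ => Finset.sum_congr rfl fun y _ => ?_
    rw [insertIdx_ofFn, lft_ofFn]
  · apply lft_ne
    simp

theorem SL.one {ℓ : ℕ} (h1 : 1 ≤ ℓ) : SL G k h ℓ (fun _ _ => 1) := by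
  induction ℓ, h1 using Nat.le_induction with
  | base => exact (SL.proj SS.base).congr fun i u => by simp
  | succ n hn ih => exact SL.app hn ih

theorem SL.total (hS : ∀ t i j, SwT (G i) k h t = SwT (G j) k h t) {ℓ : ℕ} (h1 : 1 ≤ ℓ) (h2 : ℓ ≤ k)
    {F : ∀ i, (Fin ℓ → V i) → ℚ} (hF : SL G k h ℓ F) (i j : ι) : ∑ u, F i u = ∑ u, F j u := by
  obtain ⟨ℓ, rfl⟩ : ∃ m, ℓ = m + 1 := ⟨ℓ - 1, by omega⟩
  have := SS.total hS hF i j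
  have e : ∀ i, ∑ n ∈ Finset.range k, ∑ u : Fin (n+1) → V i, lft (ℓ+1) (F i) (List.ofFn u) = ∑ u, F i u := by
    intro i
    rw [Finset.sum_eq_single ℓ]
    · simp only [lft_ofFn]
    · intro n _ hn
      refine Finset.sum_eq_zero fun u _ => lft_ne _ _ (by simpa using hn)
    · intro hc; exact absurd (Finset.mem_range.2 (by omega)) hc
  rwa [e, e] at this
end
end SWP

namespace SWP
set_option linter.unusedSectionVars false
set_option linter.unusedSimpArgs false
set_option linter.unnecessarySimpa false
open scoped Classical

section
variable {ι : Type} [Fintype ι] {V : ι → Type} [∀ i, Fintype (V i)] {G : ∀ i, SimpleGraph (V i)} {m h : ℕ}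

theorem atp_eq {A B : Type} {G : SimpleGraph A} {H : SimpleGraph B} {n : ℕ} {u : Fin n → A} {v : Fin n → B}
    (ha : atp G n u = atp H n v) (a b : Fin n) : u a = u b ↔ v a = v b :=
  iff_of_eq (congrArg Prod.fst (congrFun (congrFun ha a) b))

theorem atp_adj {A B : Type} {G : SimpleGraph A} {H : SimpleGraph B} {n : ℕ} {u : Fin n → A} {v : Fin n → B}
    (ha : atp G n u = atp H n v) (a b : Fin n) : G.Adj (u a) (u b) ↔ H.Adj (v a) (v b) :=
  iff_of_eq (congrArg Prod.snd (congrFun (congrFun ha a) b))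

theorem atp_inj {A B : Type} {G : SimpleGraph A} {H : SimpleGraph B} {n : ℕ} {u : Fin n → A} {v : Fin n → B}
    (ha : atp G n u = atp H n v) : inj u = inj v := by
  unfold inj
  refine if_congr ?_ rfl rfl
  simp only [Function.Injective, atp_eq ha]

theorem SL.minj {k ℓ : ℕ} (h1 : 1 ≤ ℓ) (h2 : ℓ ≤ k+1) {F : ∀ i, (Fin ℓ → V i) → ℚ} (hF : SL G k h ℓ F) :
    SL G k h ℓ (fun i u => inj u * F i u) :=
  SL.matp' h1 h2 (fun _ u => inj u) (fun _ _ _ _ ha => atp_inj ha) hF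

theorem SL.mwl {k : ℕ} (hk : 1 ≤ k) (θ : ∀ i, (Fin k → V i) → ℚ)
    (H : ∀ i j u v, wl (G i) k h u = wl (G j) k h v → θ i u = θ j v)
    {F : ∀ i, (Fin k → V i) → ℚ} (hF : SL G k h k F) : SL G k h k (fun i u => θ i u * F i u) :=
  SL.mulc θ (fun i j u v hc => H i j u v ((chi_wl _ _ k h hk u v).1 hc)) hF

/-- the basic exchange operator -/
theorem SL.star (hh : 1 ≤ h) (θ : ∀ i, (Fin (m+2) → V i) → ℚ)
    (H : ∀ i j u v, atp (G i) (m+2) u = atp (G j) (m+2) v → θ i u = θ j v)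
    {F : ∀ i, (Fin (m+1) → V i) → ℚ} (hF : SL G (m+1) h (m+1) F) :
    SL G (m+1) h (m+1) (fun i u => ∑ p : Fin (m+1), ∑ y, θ i (ins p.castSucc y u) * F i (ins p y (ini u))) := by
  have h1 := SL.del (by omega) le_rfl (SL.matp' (by omega) le_rfl θ H (SL.app (by omega) hF))
  have h2 := SL.mwl (by omega) (fun i u => ∑ y, θ i (Fin.snoc u y)) ?_ hF
  · refine (h1.sub h2).congr fun i u => ?_
    rw [Fin.sum_univ_castSucc (n := m+1)]
    simp only [ins_ini, ini_ins_last, Finset.sum_mul]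
    simp only [ins_last]
    ring
  · intro i j u v huv
    obtain ⟨h', rfl⟩ : ∃ h', h = h' + 1 := ⟨h - 1, by omega⟩
    obtain ⟨_, e, he⟩ := (wl_succ_iff _ _ _ _ _ _).1 huv
    exact Fintype.sum_equiv e _ _ fun y => H _ _ _ _ (he y).1

variable (G m h) in
/-- members supported on injective tuples -/
def SI (F : ∀ i, (Fin (m+1) → V i) → ℚ) : Prop := SL G (m+1) h (m+1) F ∧ ∀ i u, inj u * F i u = F i u

theorem SI.of {F : ∀ i, (Fin (m+1) → V i) → ℚ} (hF : SL G (m+1) h (m+1) F) : SI G m h (fun i u => inj u * F i u) :=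
  ⟨SL.minj (by omega) (by omega) hF, fun i u => by rw [← mul_assoc, inj_mul_inj]⟩

/-- cyclic shift map -/
def cyc (q : Fin (m+1)) : Fin (m+1) → Fin (m+1) := ins q (Fin.last m) Fin.castSucc

theorem cyc_comp {X : Type} (q : Fin (m+1)) (u : Fin (m+1) → X) : u ∘ cyc q = ins q (u (Fin.last m)) (ini u) := by
  symm
  apply ins_eq
  · simp [cyc, ins_same]
  · intro j; simp [cyc, ins_above, ini]

theorem cyc_inj (q : Fin (m+1)) : Function.Injective (cyc q) := by
  intro a b hab
  unfold cyc at hab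
  rcases Fin.eq_self_or_eq_succAbove q a with ha | ⟨j, ha⟩ <;>
  rcases Fin.eq_self_or_eq_succAbove q b with hb | ⟨j', hb⟩
  · rw [ha, hb]
  · rw [ha, hb, ins_same, ins_above] at hab
    exact absurd hab.symm (Fin.castSucc_lt_last _).ne
  · rw [ha, hb, ins_same, ins_above] at hab
    exact absurd hab (Fin.castSucc_lt_last _).ne
  · rw [ha, hb, ins_above, ins_above] at hab
    rw [ha, hb, Fin.castSucc_injective _ hab]

/-- cyclic shift permutation -/
noncomputable def cycP (q : Fin (m+1)) : Equiv.Perm (Fin (m+1)) :=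
  Equiv.ofBijective (cyc q) (Finite.injective_iff_bijective.1 (cyc_inj q))

theorem SI.cyc (hh : 1 ≤ h) (q : Fin (m+1)) {F : ∀ i, (Fin (m+1) → V i) → ℚ} (hF : SI G m h F) :
    SI G m h (fun i u => F i (u ∘ cycP q)) := by
  have h1 := SI.of (SL.star hh (fun i z => if z (Fin.last _) = z q.castSucc then 1 else 0)
    (by intro i j u v ha; exact if_congr (atp_eq ha _ _) rfl rfl) hF.1)
  have e : ∀ i (u : Fin (m+1) → V i), F i (u ∘ cycP q) = inj u * ∑ p : Fin (m+1), ∑ y,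
      (if ins p.castSucc y u (Fin.last _) = ins p.castSucc y u q.castSucc then 1 else 0) * F i (ins p y (ini u)) := by
    intro i u
    by_cases hu : Function.Injective u
    · rw [inj, if_pos hu, one_mul, Finset.sum_eq_single q]
      · rw [Finset.sum_eq_single (u (Fin.last m))]
        · rw [ins_same, ins_last', if_pos rfl, one_mul, ← cyc_comp]; rfl
        · intro y _ hy
          rw [ins_same, ins_last', if_neg hy.symm, zero_mul]
        · simp
      · intro p _ hp
        refine Finset.sum_eq_zero fun y _ => ?_
        rw [if_neg, zero_mul]
        rw [ins_last']
        obtain ⟨j, hj⟩ := Fin.exists_succAbove_eq hp.symm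
        have : ins p.castSucc y u q.castSucc = u j.castSucc := by
          have := congrFun (ins_ini p y u) q
          rw [← hj, ins_above] at this
          rw [← hj]; exact this
        rw [this]
        intro hc
        exact absurd (hu hc).symm (Fin.castSucc_lt_last _).ne
      · simp
    · rw [← hF.2, inj, inj, if_neg, if_neg hu, zero_mul, zero_mul]
      intro hc
      exact hu ((Function.Injective.of_comp_iff' u (cycP q).bijective).1 hc)
  have e' : (fun i u => F i (u ∘ cycP q)) = _ := funext fun i => funext fun u => e i u
  rw [e']; exact h1

theorem SI.cycPow (hh : 1 ≤ h) (q : Fin (m+1)) (n : ℕ) {F : ∀ i, (Fin (m+1) → V i) → ℚ} (hF : SI G m h F) :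
    SI G m h (fun i u => F i (u ∘ (cycP q ^ n : Equiv.Perm _))) := by
  induction n with
  | zero => simpa using hF
  | succ n ih =>
    have := SI.cyc hh q ih
    convert this using 4
    rw [pow_succ']; rfl

theorem SI.cycInv (hh : 1 ≤ h) (q : Fin (m+1)) {F : ∀ i, (Fin (m+1) → V i) → ℚ} (hF : SI G m h F) :
    SI G m h (fun i u => F i (u ∘ ((cycP q)⁻¹ : Equiv.Perm _))) := by
  have : (cycP q)⁻¹ = cycP q ^ (orderOf (cycP q) - 1) := by
    apply inv_eq_of_mul_eq_one_left
    rw [← pow_succ, Nat.sub_add_cancel (orderOf_pos _), pow_orderOf_eq_one]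
  rw [this]
  exact SI.cycPow hh q _ hF

theorem del_eq {X : Type} [Fintype X] {n : ℕ} (Ψ : (Fin (n+1) → X) → ℚ) (u : Fin (n+1) → X) :
    ∑ p : Fin (n+2), ∑ y, (if ins p y u (Fin.last _) = ins p y u (Fin.last _).castSucc then 1 else 0) * Ψ (ini (ins p y u)) =
    2 * Ψ u + ∑ p : Fin n, ∑ y, (if u (Fin.last _) = ins p.castSucc y (ini u) (Fin.last _) then 1 else 0) *
      Ψ (ins p.castSucc y (ini u)) := by
  rw [Fin.sum_univ_castSucc (n := n+1)]
  have e1 : ∀ p : Fin (n+2), ∀ y, ins p y u (Fin.last _).castSucc = ini (ins p y u) (Fin.last _) := fun _ _ => rfl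
  simp only [e1, ins_ini, ins_last', ini_ins_last, ins_same]
  rw [Fin.sum_univ_castSucc (n := n)]
  simp only [ins_same]
  have e2 : ∑ y, (if u (Fin.last n) = y then 1 else 0) * Ψ (ins (Fin.last n) y (ini u)) = Ψ u := by
    simp only [ite_mul, one_mul, zero_mul, Finset.sum_ite_eq, Finset.mem_univ, if_true]
    rw [ins_last_ini, Function.update_eq_self]
  have e3 : ∑ y, (if y = u (Fin.last n) then 1 else 0) * Ψ u = Ψ u := by
    simp
  rw [e2, e3]; ring

theorem inj_ini {X : Type} {n : ℕ} (u : Fin (n+1) → X) : inj u * inj (ini u) = inj u := by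
  unfold inj
  by_cases hu : Function.Injective u
  · have hi : Function.Injective (ini u) := hu.comp (Fin.castSucc_injective _)
    rw [if_pos hu, if_pos hi]; simp
  · simp [hu]

theorem SI.allLast (hh : 1 ≤ h) {F : ∀ i, (Fin (m+1) → V i) → ℚ} (hF : SI G m h F) :
    SI G m h (fun i u => inj u * ∑ y, F i (Function.update u (Fin.last m) y)) := by
  rcases m with _ | m
  · refine SI.of ((SL.star hh (fun _ _ => 1) (fun _ _ _ _ _ => rfl) hF.1).congr fun i u => ?_)
    rw [Fin.sum_univ_castSucc]
    simp only [Finset.univ_eq_empty, Finset.sum_empty, zero_add, one_mul, ins_last_ini]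
  · have hm : ∀ n, ∀ i j (u : Fin (n+2) → V i) (v : Fin (n+2) → V j), atp (G i) (n+2) u = atp (G j) (n+2) v →
        (if u (Fin.last _) = u (Fin.last _).castSucc then (1:ℚ) else 0) = if v (Fin.last _) = v (Fin.last _).castSucc then 1 else 0 := by
      intro n i j u v ha; exact if_congr (atp_eq ha _ _) rfl rfl
    have p1 := SL.matp' (by omega) (by omega) (fun i z => if z (Fin.last _) = z (Fin.last _).castSucc then 1 else 0) (hm _) (SL.app (by omega) hF.1)
    have p2 := SL.del (by omega) (by omega) p1
    simp only [del_eq] at p2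
    let B : ∀ i, (Fin (m+1) → V i) → ℚ := fun i r => ∑ p : Fin (m+1), ∑ y, F i (ins p.castSucc y r)
    have p3 := SL.matp' (by omega) (by omega) (fun i z => if z (Fin.last _) = z (Fin.last _).castSucc then 1 else 0) (hm _) p2
    have p4 : SL G (m+1+1) h (m+1+1) (fun i z => (if z (Fin.last _) = z (Fin.last _).castSucc then 1 else 0) * B i (ini z)) := by
      refine p3.congr fun i z => ?_
      by_cases hz : z (Fin.last _) = z (Fin.last _).castSucc
      · rw [if_pos hz, one_mul, one_mul]
        have : F i z = 0 := by
          rw [← hF.2, inj, if_neg, zero_mul]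
          intro hc
          exact absurd (hc hz).symm (Fin.castSucc_lt_last _).ne
        rw [this, mul_zero, zero_add]
        refine Finset.sum_congr rfl fun p _ => Finset.sum_congr rfl fun y _ => ?_
        rw [ins_last', if_pos, one_mul]
        exact hz
      · rw [if_neg hz, zero_mul, zero_mul]
    have p5 := SL.minj (by omega) (by omega) (SL.del (by omega) (by omega) p4)
    simp only [del_eq] at p5
    have p6 := SL.minj (by omega) (by omega) (SL.del (by omega) (by omega) hF.1)
    have p7 := SL.app (by omega) (p6.sub (p5.smul (1/2)))
    have p8 := SI.of p7
    convert p8 using 3 with i u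
    rw [← inj_ini u, mul_assoc, mul_assoc]
    congr 1
    generalize hr : ini u = r
    rw [Fin.sum_univ_castSucc (n := m+1)]
    have e : inj r * ∑ p : Fin m, ∑ y, (if r (Fin.last _) = ins p.castSucc y (ini r) (Fin.last _) then 1 else 0) *
      B i (ins p.castSucc y (ini r)) = 0 := by
      by_cases hi : Function.Injective r
      · rw [Finset.sum_eq_zero, mul_zero]
        intro p _
        refine Finset.sum_eq_zero fun y _ => ?_
        rw [if_neg, zero_mul]
        obtain ⟨j, hj⟩ := Fin.exists_succAbove_eq (Fin.castSucc_lt_last p).ne'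
        rw [← hj, ins_above, hj]
        intro hc
        exact absurd (hi hc).symm (Fin.castSucc_lt_last _).ne
      · rw [inj, if_neg hi, zero_mul]
    rw [mul_add (inj r) (2 * _), e]
    have e2 : ∀ y, Function.update u (Fin.last (m+1)) y = ins (Fin.last (m+1)) y r := by
      intro y; rw [← hr, ins_last_ini]
    simp only [e2]
    have hii := inj_mul_inj r
    show _ = inj r * ((inj r * (B i r + _)) - _)
    linear_combination (- (∑ y, F i (ins (Fin.last (m+1)) y r))) * hii

end
end SWP

namespace SWP
set_option linter.unusedSectionVars false
set_option linter.unusedSimpArgs false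
set_option linter.unnecessarySimpa false
open scoped Classical

section
variable {ι : Type} [Fintype ι] {V : ι → Type} [∀ i, Fintype (V i)] {G : ∀ i, SimpleGraph (V i)} {m h : ℕ}

theorem SI.add {F F' : ∀ i, (Fin (m+1) → V i) → ℚ} (hF : SI G m h F) (hF' : SI G m h F') :
    SI G m h (fun i u => F i u + F' i u) :=
  ⟨hF.1.add hF'.1, fun i u => by rw [mul_add, hF.2, hF'.2]⟩

theorem SI.smul (c : ℚ) {F : ∀ i, (Fin (m+1) → V i) → ℚ} (hF : SI G m h F) :
    SI G m h (fun i u => c * F i u) :=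
  ⟨hF.1.smul c, fun i u => by rw [mul_left_comm, hF.2]⟩

theorem SI.adjLast (hh : 1 ≤ h) {F : ∀ i, (Fin (m+1) → V i) → ℚ} (hF : SI G m h F) :
    SI G m h (fun i u => inj u * ∑ y, (if (G i).Adj (u (Fin.last m)) y then 1 else 0) *
      F i (Function.update u (Fin.last m) y)) := by
  have hm : ∀ n, ∀ i j (u : Fin (n+2) → V i) (v : Fin (n+2) → V j), atp (G i) (n+2) u = atp (G j) (n+2) v →
        (if (G i).Adj (u (Fin.last _)) (u (Fin.last _).castSucc) then (1:ℚ) else 0) =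
        if (G j).Adj (v (Fin.last _)) (v (Fin.last _).castSucc) then 1 else 0 := by
    intro n i j u v ha; exact if_congr (atp_adj ha _ _) rfl rfl
  have hm' : ∀ n, ∀ i j (u : Fin (n+2) → V i) (v : Fin (n+2) → V j), atp (G i) (n+2) u = atp (G j) (n+2) v →
        1 - (if (G i).Adj (u (Fin.last _)) (u (Fin.last _).castSucc) then (1:ℚ) else 0) =
        1 - if (G j).Adj (v (Fin.last _)) (v (Fin.last _).castSucc) then 1 else 0 := by
    intro n i j u v ha; rw [hm n i j u v ha]
  rcases m with _ | m
  · refine SI.of ((SL.star hh _ (hm _) hF.1).congr fun i u => ?_)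
    rw [Fin.sum_univ_castSucc]
    simp only [Finset.univ_eq_empty, Finset.sum_empty, zero_add, ins_last_ini]
    refine Finset.sum_congr rfl fun y _ => ?_
    rw [ins_last', ins_same]
  · have A1 := SI.of (SL.matp' (by omega) (by omega) _ (hm' m) (SL.star hh _ (hm (m+1)) hF.1))
    have A2 := SI.of (SL.matp' (by omega) (by omega) _ (hm m) (SL.star hh _ (hm' (m+1)) hF.1))
    have A3 := SI.of (SL.matp' (by omega) (by omega) _ (hm m) (SI.allLast hh hF).1)
    have A4 := (A1.add A3).add (A2.smul (-1))
    convert A4 using 3 with i u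
    have key : ∀ (p : Fin (m+2)) y, ins p.castSucc y u (Fin.last (m+1)).castSucc = ins p y (ini u) (Fin.last (m+1)) := by
      intro p y; exact congrFun (ins_ini p y u) (Fin.last _)
    simp only [ins_last', key]
    rw [Fin.sum_univ_castSucc (n := m+1), Fin.sum_univ_castSucc (n := m+1)]
    simp only [ins_last', ins_same, ins_last_ini, ini]
    have hii := inj_mul_inj u
    by_cases ha : (G i).Adj (u (Fin.last (m+1))) (u (Fin.last m).castSucc)
    · simp only [if_pos ha, sub_mul, one_mul, Finset.sum_sub_distrib]
      simp only [sub_self, Finset.sum_const_zero]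
      linear_combination (-(∑ y, F i (Function.update u (Fin.last (m+1)) y))) * hii
    · simp only [if_neg ha, zero_mul, Finset.sum_const_zero]
      ring

theorem inj_perm {X : Type} {n : ℕ} (u : Fin n → X) (γ : Equiv.Perm (Fin n)) : inj (u ∘ γ) = inj u := by
  unfold inj
  exact if_congr (Function.Injective.of_comp_iff' u γ.bijective) rfl rfl

theorem cycP_self (p : Fin (m+1)) : cycP p p = Fin.last m := ins_same _ _ _

theorem upd_perm {X : Type} {n : ℕ} (u : Fin n → X) (γ : Equiv.Perm (Fin n)) (p q : Fin n) (hp : γ p = q) (y : X) :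
    (Function.update (u ∘ (γ⁻¹ : Equiv.Perm _)) q y) ∘ γ = Function.update u p y := by
  subst hp
  funext a
  by_cases ha : a = p
  · subst ha; simp
  · have : γ a ≠ γ p := fun hc => ha (γ.injective hc)
    simp [Function.update_of_ne this, Function.update_of_ne ha]

theorem SI.all (hh : 1 ≤ h) (p : Fin (m+1)) {F : ∀ i, (Fin (m+1) → V i) → ℚ} (hF : SI G m h F) :
    SI G m h (fun i u => inj u * ∑ y, F i (Function.update u p y)) := by
  have h1 := SI.cycInv hh p (SI.allLast hh (SI.cyc hh p hF))
  -- conjugating back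
  let γ := cycP p
  have e : ∀ i (u : Fin (m+1) → V i) y, (Function.update (u ∘ ((cycP p)⁻¹ : Equiv.Perm _)) (Fin.last m) y) ∘ (cycP p) = Function.update u p y :=
    fun i u y => upd_perm u (cycP p) p _ (cycP_self p) y
  simp only [e, inj_perm] at h1
  exact h1

theorem SI.adj (hh : 1 ≤ h) (p : Fin (m+1)) {F : ∀ i, (Fin (m+1) → V i) → ℚ} (hF : SI G m h F) :
    SI G m h (fun i u => inj u * ∑ y, (if (G i).Adj (u p) y then 1 else 0) * F i (Function.update u p y)) := by
  have h1 := SI.cycInv hh p (SI.adjLast hh (SI.cyc hh p hF))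
  have e : ∀ i (u : Fin (m+1) → V i) y, (Function.update (u ∘ ((cycP p)⁻¹ : Equiv.Perm _)) (Fin.last m) y) ∘ (cycP p) = Function.update u p y :=
    fun i u y => upd_perm u (cycP p) p _ (cycP_self p) y
  have e2 : ∀ i (u : Fin (m+1) → V i), (u ∘ ((cycP p)⁻¹ : Equiv.Perm _)) (Fin.last m) = u p := by
    intro i u
    rw [← cycP_self p]; simp
  simp only [e, inj_perm, e2] at h1
  exact h1

theorem RI.si (hh : 1 ≤ h) {F : ∀ i, (Fin (m+1) → V i) → ℚ} (hF : RI G (m+1) h F) : SI G m h F := by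
  induction hF with
  | one => simpa using SI.of (G := G) (h := h) (SL.one (k := m+1) (ℓ := m+1) (by omega))
  | add _ _ h1 h2 => exact h1.add h2
  | smul c _ h1 => exact h1.smul c
  | mul g _ h1 =>
    exact ⟨SL.mwl (by omega) (fun i u => g (wl (G i) (m+1) h u)) (fun i j u v e => by rw [e]) h1.1,
      fun i u => by rw [mul_left_comm, h1.2]⟩
  | all p _ h1 => exact h1.all hh p
  | adj p _ h1 => exact h1.adj hh p

theorem hub_of_sw {k : ℕ} (hk : 1 ≤ k) (hh : 1 ≤ h) (hS : ∀ t i j, SwT (G i) k h t = SwT (G j) k h t) : Hub G k h := by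
  obtain ⟨m, rfl⟩ : ∃ m, k = m + 1 := ⟨k - 1, by omega⟩
  refine ⟨?_, ?_, ?_⟩
  · intro i j
    have := SL.total hS le_rfl (by omega) (SL.one (G := G) (k := m+1) (h := h) (ℓ := 1) le_rfl) i j
    simpa using this
  · intro i j ℓ h1 h2 u _
    have := SL.total hS h1 h2 (SL.matp' h1 (by omega) (fun i' u' => if atp (G i) ℓ u = atp (G i') ℓ u' then (1:ℚ) else 0)
      (fun i' j' u' v' ha => by rw [ha]) (SL.one (G := G) (k := m+1) (h := h) (ℓ := ℓ) h1)) i j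
    by_contra hc
    push Not at hc
    simp only [mul_one] at this
    rw [Finset.sum_eq_zero (s := (Finset.univ : Finset (Fin ℓ → V j))) (fun v _ => if_neg (hc v))] at this
    have h3 := (Finset.sum_eq_zero_iff_of_nonneg (fun v _ => by split_ifs <;> norm_num)).1 this u (Finset.mem_univ _)
    simp at h3
  · intro F hF i j
    exact SL.total hS (by omega) le_rfl (hF.si hh).1 i j

end
end SWP

namespace SWP
set_option linter.unusedSectionVars false
set_option linter.unusedSimpArgs false
set_option linter.unnecessarySimpa false
open scoped Classical

section
/-- the two vertex types as a family -/
def VV (V W : Type) : Bool → Type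
  | false => V
  | true => W

instance instVV (V W : Type) [Fintype V] [Fintype W] : ∀ b, Fintype (VV V W b)
  | false => inferInstanceAs (Fintype V)
  | true => inferInstanceAs (Fintype W)

/-- the two graphs as a family -/
def GG {V W : Type} (G : SimpleGraph V) (H : SimpleGraph W) : ∀ b, SimpleGraph (VV V W b)
  | false => G
  | true => H

theorem main {V W : Type} [iV : Fintype V] [iW : Fintype W]
    (k h : ℕ) (hk : 1 ≤ k) (hh : 1 ≤ h)
    (G : SimpleGraph V) (H : SimpleGraph W) :
    (∀ w : List (Letter ↥(colorSet G H k h) k),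
        swaSeries G k h Subtype.val w = swaSeries H k h Subtype.val w) ↔
      ∀ t : ℕ, SwT G k h t = SwT H k h t := by
  constructor
  · intro hA t
    refine Hub.sw (G := GG G H) hk hh (hub_of_swa (G := GG G H) (cval := (Subtype.val : ↥(colorSet G H k h) → _)) hk ?_ ?_) t false true
    · rintro (_ | _) l x hx
      · exact ⟨⟨x, Or.inl ⟨l, hx⟩⟩, rfl⟩
      · exact ⟨⟨x, Or.inr ⟨l, hx⟩⟩, rfl⟩
    · rintro w (_ | _) (_ | _)
      · rfl
      · exact hA w
      · exact (hA w).symm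
      · rfl
  · intro hS w
    refine Hub.swa (G := GG G H) hk (hub_of_sw (G := GG G H) hk hh ?_) _ w false true
    rintro t (_ | _) (_ | _)
    · rfl
    · exact hS t
    · exact (hS t).symm
    · rfl
end
end SWP

/-- For `k, h ≥ 1`, the simplicial walk automata of `G` and `H` over the
common alphabet whose color symbols range over the union of the images of `χ_{k,h}`
recognize the same rational series iff `Sww_{(k,h)}(G) = Sww_{(k,h)}(H)`. -/
theorem swa_series_eq_iff_sww_eq
    {V W : Type} [Fintype V] [DecidableEq V] [Fintype W] [DecidableEq W]
    (k h : ℕ) (hk : 1 ≤ k) (hh : 1 ≤ h)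
    (G : SimpleGraph V) (H : SimpleGraph W) :
    (∀ w : List (Letter ↥(colorSet G H k h) k),
        swaSeries G k h Subtype.val w = swaSeries H k h Subtype.val w) ↔
      ∀ t : ℕ, SwT G k h t = SwT H k h t := by
  convert SWP.main k h hk hh G H using 5
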